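/- There exists a universal constant C > 0 such that for every weighted graph G = (V,E,w) on n ≥ 2 vertices and every parameter 0 < ρ < 1, there exists a spanning tree T of G with lightness Ψ(T) ≤ 1 + ρ and average distortion dist_1(T,G) ≤ C/ρ. -/

import Mathlib

open Finset

attribute [local instance] Classical.propDecidable

section Defs

variable {V : Type*} [Fintype V]

/-- Total weight of a (sub)graph: the sum of its edge weights. -/
noncomputable def wWeight (H : SimpleGraph V) (w : Sym2 V → ℝ) : ℝ :=
  ∑ e ∈ H.edgeSet.toFinite.toFinset, w e

/-- Shortest-path distance in a weighted graph: infimum of walk weights. -/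
noncomputable def wdist (G : SimpleGraph V) (w : Sym2 V → ℝ) (u v : V) : ℝ :=
  sInf {x : ℝ | ∃ p : G.Walk u v, x = (p.edges.map w).sum}

/-- `T` is a spanning tree of `G`. -/
def IsSpanningTree (G T : SimpleGraph V) : Prop :=
  T ≤ G ∧ T.IsTree

/-- Weight of a minimum spanning tree of `G`. -/
noncomputable def mstWeight (G : SimpleGraph V) (w : Sym2 V → ℝ) : ℝ :=
  sInf {x : ℝ | ∃ T : SimpleGraph V, IsSpanningTree G T ∧ x = wWeight T w}

/-- `T` is a minimum spanning tree of `G`. -/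
def IsMST (G : SimpleGraph V) (w : Sym2 V → ℝ) (T : SimpleGraph V) : Prop :=
  IsSpanningTree G T ∧ ∀ T' : SimpleGraph V, IsSpanningTree G T' → wWeight T w ≤ wWeight T' w

/-- A spanner of `G`: a connected spanning subgraph. -/
def IsSpanner (G H : SimpleGraph V) : Prop := H ≤ G ∧ H.Connected

/-- `G` together with `w` is a weighted graph: connected, positive pairwise-distinct
edge weights. -/
def IsWeightedGraph (G : SimpleGraph V) (w : Sym2 V → ℝ) : Prop :=
  G.Connected ∧ (∀ e ∈ G.edgeSet, 0 < w e) ∧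
    (∀ e ∈ G.edgeSet, ∀ e' ∈ G.edgeSet, e ≠ e' → w e ≠ w e')

/-- The ordered pairs of distinct vertices whose distortion in `H` is at most `t`. -/
noncomputable def goodPairs (G H : SimpleGraph V) (w : Sym2 V → ℝ) (t : ℝ) : Finset (V × V) :=
  Finset.univ.offDiag.filter (fun p => wdist H w p.1 p.2 ≤ t * wdist G w p.1 p.2)

/-- Scaling distortion `γ`: for every `ε ∈ (0,1)`, at least a `(1-ε)` fraction of the
pairs of distinct vertices have distortion at most `γ ε`.  (Counted over ordered pairs:
`n·(n-1) = 2·(n choose 2)`.) -/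
def HasScalingDistortion (G H : SimpleGraph V) (w : Sym2 V → ℝ) (γ : ℝ → ℝ) : Prop :=
  ∀ ε : ℝ, 0 < ε → ε < 1 →
    (1 - ε) * ((Fintype.card V : ℝ) * ((Fintype.card V : ℝ) - 1)) ≤
      ((goodPairs G H w (γ ε)).card : ℝ)

/-- The `ℓ_q`-distortion of the spanner `H` of `G`. -/
noncomputable def distq (G H : SimpleGraph V) (w : Sym2 V → ℝ) (q : ℝ) : ℝ :=
  ((∑ p ∈ (Finset.univ : Finset V).offDiag, (wdist H w p.1 p.2 / wdist G w p.1 p.2) ^ q) /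
    ((Fintype.card V : ℝ) * ((Fintype.card V : ℝ) - 1))) ^ (1 / q)

/-- `R(v,ε)`: the minimal radius `r` such that the ball `B(v,r)` contains at least `εn`
vertices. -/
noncomputable def Rgraph (G : SimpleGraph V) (w : Sym2 V → ℝ) (v : V) (ε : ℝ) : ℝ :=
  sInf {r : ℝ | 0 ≤ r ∧
    ε * (Fintype.card V : ℝ) ≤ ((Finset.univ.filter (fun u => wdist G w u v ≤ r)).card : ℝ)}

/-- Coarse scaling distortion `γ`: every pair of distinct vertices that are mutually
`ε/2`-far has distortion at most `γ ε`. -/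
def HasCoarseScalingDistortion (G H : SimpleGraph V) (w : Sym2 V → ℝ) (γ : ℝ → ℝ) : Prop :=
  ∀ ε : ℝ, 0 < ε → ε < 1 → ∀ u v : V, u ≠ v →
    Rgraph G w v (ε / 2) ≤ wdist G w u v → Rgraph G w u (ε / 2) ≤ wdist G w u v →
    wdist H w u v ≤ γ ε * wdist G w u v

end Defs

namespace LightTree

section Walks

variable {V : Type*}

/-- Total weight of a walk. -/
noncomputable def wlen (w : Sym2 V → ℝ) {A : SimpleGraph V} {a b : V} (p : A.Walk a b) : ℝ :=
  (p.edges.map w).sum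

/-- `b` can be reached from `a` inside `A` by a walk of weight at most `ℓ`. -/
def Rc (A : SimpleGraph V) (w : Sym2 V → ℝ) (a b : V) (ℓ : ℝ) : Prop :=
  ∃ p : A.Walk a b, wlen w p ≤ ℓ

/-- `w` is nonnegative on the edges of `A`. -/
def NonnegOn (A : SimpleGraph V) (w : Sym2 V → ℝ) : Prop :=
  ∀ a b, A.Adj a b → 0 ≤ w s(a, b)

variable {A B : SimpleGraph V} {w w' : Sym2 V → ℝ} {a b c : V} {ℓ ℓ' : ℝ}

@[simp] lemma wlen_nil : wlen w (SimpleGraph.Walk.nil : A.Walk a a) = 0 := by simp [wlen]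

@[simp] lemma wlen_cons (h : A.Adj a b) (p : A.Walk b c) :
    wlen w (SimpleGraph.Walk.cons h p) = w s(a, b) + wlen w p := by simp [wlen]

lemma wlen_append (p : A.Walk a b) (q : A.Walk b c) :
    wlen w (p.append q) = wlen w p + wlen w q := by simp [wlen]

lemma wlen_reverse (p : A.Walk a b) : wlen w p.reverse = wlen w p := by
  simp [wlen]

lemma NonnegOn.wlen_nonneg (hw : NonnegOn A w) (p : A.Walk a b) : 0 ≤ wlen w p := by
  induction p with
  | nil => simp
  | cons h p ih => rw [wlen_cons]; exact add_nonneg (hw _ _ h) ih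

lemma NonnegOn.mono (hw : NonnegOn B w) (h : A ≤ B) : NonnegOn A w := fun a b hab => hw a b (h hab)

lemma Rc.refl (hℓ : 0 ≤ ℓ) : Rc A w a a ℓ := ⟨.nil, by simpa using hℓ⟩

lemma Rc.symm (h : Rc A w a b ℓ) : Rc A w b a ℓ := by
  obtain ⟨p, hp⟩ := h
  exact ⟨p.reverse, by rwa [wlen_reverse]⟩

lemma Rc.trans (h : Rc A w a b ℓ) (h' : Rc A w b c ℓ') : Rc A w a c (ℓ + ℓ') := by
  obtain ⟨p, hp⟩ := h
  obtain ⟨q, hq⟩ := h'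
  exact ⟨p.append q, by rw [wlen_append]; linarith⟩

lemma Rc.le (h : Rc A w a b ℓ) (hl : ℓ ≤ ℓ') : Rc A w a b ℓ' := by
  obtain ⟨p, hp⟩ := h
  exact ⟨p, hp.trans hl⟩

lemma Rc.adj (h : A.Adj a b) : Rc A w a b (w s(a, b)) := ⟨.cons h .nil, by simp⟩

lemma Rc.reachable (h : Rc A w a b ℓ) : A.Reachable a b := by
  obtain ⟨p, -⟩ := h
  exact ⟨p⟩

lemma Rc.nonneg (hw : NonnegOn A w) (h : Rc A w a b ℓ) : 0 ≤ ℓ := by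
  obtain ⟨p, hp⟩ := h
  exact (hw.wlen_nonneg p).trans hp

lemma Rc.of_walk (p : A.Walk a b) : Rc A w a b (wlen w p) := ⟨p, le_rfl⟩

/-- Transport a walk to another weighted graph. -/
lemma Rc.map (h : Rc A w a b ℓ) (hAB : A ≤ B)
    (hw : ∀ x y, A.Adj x y → w' s(x, y) ≤ w s(x, y)) : Rc B w' a b ℓ := by
  obtain ⟨p, hp⟩ := h
  have key : ∀ {x y : V} (p : A.Walk x y), Rc B w' x y (wlen w p) := by
    intro x y p
    induction p with
    | nil => exact Rc.refl (by simp)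
    | cons h p ih =>
      rw [wlen_cons]
      exact ((Rc.adj (hAB h)).le (hw _ _ h)).trans ih
  exact (key p).le hp

lemma Rc.mono (h : Rc A w a b ℓ) (hAB : A ≤ B) : Rc B w a b ℓ :=
  h.map hAB fun _ _ _ => le_rfl

/-- Transport a walk with a multiplicative loss. -/
lemma Rc.map_mul (h : Rc A w a b ℓ) {K : ℝ} (hK : 0 ≤ K)
    (hw : ∀ x y, A.Adj x y → Rc B w' x y (K * w s(x, y))) : Rc B w' a b (K * ℓ) := by
  obtain ⟨p, hp⟩ := h
  have key : ∀ {x y : V} (p : A.Walk x y), Rc B w' x y (K * wlen w p) := by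
    intro x y p
    induction p with
    | nil => exact Rc.refl (by simp)
    | cons h p ih =>
      rw [wlen_cons, mul_add]
      exact (hw _ _ h).trans ih
  exact (key p).le (mul_le_mul_of_nonneg_left hp hK)

section Dist

lemma wdist_le (hw : NonnegOn A w) (h : Rc A w a b ℓ) : wdist A w a b ≤ ℓ := by
  obtain ⟨p, hp⟩ := h
  refine le_trans (csInf_le ⟨0, ?_⟩ ⟨p, rfl⟩) hp
  rintro x ⟨q, rfl⟩
  exact hw.wlen_nonneg q

lemma wlen_bypass_le (hw : NonnegOn A w) (p : A.Walk a b) : wlen w p.bypass ≤ wlen w p := by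
  induction p with
  | nil => simp [SimpleGraph.Walk.bypass]
  | @cons u v x h p ih =>
    simp only [SimpleGraph.Walk.bypass]
    split_ifs with hs
    · have h1 := congrArg (wlen w) (SimpleGraph.Walk.take_spec p.bypass hs)
      rw [wlen_append] at h1
      have h2 := hw.wlen_nonneg (p.bypass.takeUntil u hs)
      have h3 := hw _ _ h
      rw [wlen_cons]
      linarith
    · rw [wlen_cons, wlen_cons]; linarith

lemma rc_wdist [Fintype V] (hw : NonnegOn A w) (h : A.Reachable a b) :
    Rc A w a b (wdist A w a b) := by
  have hfin : {l : List (Sym2 V) | ∃ p : A.Walk a b, p.IsPath ∧ p.edges = l}.Finite := by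
    refine (List.finite_length_le (Sym2 V) (Fintype.card V)).subset ?_
    rintro l ⟨p, hp, rfl⟩
    simpa using hp.length_lt.le
  obtain ⟨q⟩ := h
  obtain ⟨l, ⟨p, hp, rfl⟩, hmin⟩ := Set.exists_min_image _ (fun l : List (Sym2 V) => (l.map w).sum)
    hfin ⟨_, q.bypass, q.bypass_isPath, rfl⟩
  refine ⟨p, le_csInf ⟨_, p, rfl⟩ ?_⟩
  rintro x ⟨r, rfl⟩
  exact (hmin _ ⟨r.bypass, r.bypass_isPath, rfl⟩).trans (wlen_bypass_le hw r)

lemma wdist_nonneg (hw : NonnegOn A w) : 0 ≤ wdist A w a b := by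
  refine Real.sInf_nonneg ?_
  rintro x ⟨q, rfl⟩
  exact hw.wlen_nonneg q

lemma wdist_self (hw : NonnegOn A w) : wdist A w a a = 0 :=
  le_antisymm (wdist_le hw (Rc.refl le_rfl)) (wdist_nonneg hw)

lemma wdist_comm (A : SimpleGraph V) (w : Sym2 V → ℝ) (a b : V) :
    wdist A w a b = wdist A w b a := by
  have : {x : ℝ | ∃ p : A.Walk a b, x = (p.edges.map w).sum} =
      {x : ℝ | ∃ p : A.Walk b a, x = (p.edges.map w).sum} := by
    ext x
    constructor
    · rintro ⟨p, rfl⟩; exact ⟨p.reverse, (wlen_reverse p).symm⟩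
    · rintro ⟨p, rfl⟩; exact ⟨p.reverse, (wlen_reverse p).symm⟩
  rw [wdist, wdist, this]

lemma wdist_triangle [Fintype V] (hw : NonnegOn A w) (hab : A.Reachable a b)
    (hbc : A.Reachable b c) : wdist A w a c ≤ wdist A w a b + wdist A w b c :=
  wdist_le hw ((rc_wdist hw hab).trans (rc_wdist hw hbc))

lemma wdist_pos [Fintype V] (hw : ∀ a b, A.Adj a b → 0 < w s(a, b)) (hab : A.Reachable a b)
    (hne : a ≠ b) : 0 < wdist A w a b := by
  have hw' : NonnegOn A w := fun a b h => (hw a b h).le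
  obtain ⟨p, hp⟩ := rc_wdist hw' hab
  refine lt_of_lt_of_le ?_ hp
  cases p with
  | nil => exact absurd rfl hne
  | cons h p => rw [wlen_cons]; exact add_pos_of_pos_of_nonneg (hw _ _ h) (hw'.wlen_nonneg p)

end Dist

section Restrict

/-- The graph `G` restricted to the vertices in `Y` (on the same vertex type). -/
def rs (G : SimpleGraph V) (Y : Finset V) : SimpleGraph V where
  Adj a b := G.Adj a b ∧ a ∈ Y ∧ b ∈ Y
  symm := ⟨fun _ _ h => ⟨h.1.symm, h.2.2, h.2.1⟩⟩
  loopless := ⟨fun _ h => G.loopless.irrefl _ h.1⟩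

variable {G : SimpleGraph V} {Y Z : Finset V}

lemma rs_le : rs G Y ≤ G := fun _ _ h => h.1

lemma rs_mono (h : Y ⊆ Z) : rs G Y ≤ rs G Z := fun _ _ hab => ⟨hab.1, h hab.2.1, h hab.2.2⟩

lemma Rc.mem_rs (h : Rc (rs G Y) w a b ℓ) (ha : a ∈ Y) : b ∈ Y := by
  obtain ⟨p, -⟩ := h
  induction p with
  | nil => exact ha
  | cons h p ih => exact ih h.2.2

/-- Either a walk in `Y` stays in `Z`, or it passes through a vertex outside `Z`. -/
lemma Rc.cut (h : Rc (rs G Y) w a b ℓ) (ha : a ∈ Y) :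
    Rc (rs G Z) w a b ℓ ∨ ∃ c ∈ Y, c ∉ Z ∧ ∃ ℓ₁ ℓ₂, ℓ₁ + ℓ₂ ≤ ℓ ∧
      Rc (rs G Y) w a c ℓ₁ ∧ Rc (rs G Y) w c b ℓ₂ := by
  obtain ⟨p, hp⟩ := h
  have key : ∀ {x y : V} (p : (rs G Y).Walk x y), x ∈ Y → Rc (rs G Z) w x y (wlen w p) ∨
      ∃ c ∈ Y, c ∉ Z ∧ ∃ ℓ₁ ℓ₂, ℓ₁ + ℓ₂ ≤ wlen w p ∧
      Rc (rs G Y) w x c ℓ₁ ∧ Rc (rs G Y) w c y ℓ₂ := by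
    intro x y p hx
    induction p with
    | nil => exact .inl (Rc.refl (by simp))
    | @cons u v z h p ih =>
      rw [wlen_cons]
      by_cases hu : u ∈ Z
      · by_cases hv : v ∈ Z
        · rcases ih h.2.2 with ih | ⟨c, hcY, hcZ, ℓ₁, ℓ₂, h12, h1, h2⟩
          · exact .inl ((Rc.adj (A := rs G Z) ⟨h.1, hu, hv⟩).trans ih)
          · exact .inr ⟨c, hcY, hcZ, w s(u, v) + ℓ₁, ℓ₂, by linarith, (Rc.adj h).trans h1, h2⟩
        · exact .inr ⟨v, h.2.2, hv, w s(u, v), wlen w p, le_rfl, Rc.adj h, Rc.of_walk p⟩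
      · exact .inr ⟨u, hx, hu, 0, _, by rw [zero_add], Rc.refl le_rfl,
          (Rc.adj h).trans (Rc.of_walk p)⟩
  rcases key p ha with h | ⟨c, hc, hc', ℓ₁, ℓ₂, h, h'⟩
  · exact .inl (h.le hp)
  · exact .inr ⟨c, hc, hc', ℓ₁, ℓ₂, h.trans hp, h'⟩

/-- A shortest walk stays in `Z` if every vertex on a geodesic lies in `Z`. -/
lemma Rc.restrict [Fintype V] (hw : NonnegOn (rs G Y) w) (ha : a ∈ Y)
    (hr : (rs G Y).Reachable a b)
    (hZ : ∀ c ∈ Y, (rs G Y).Reachable a c → (rs G Y).Reachable c b →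
      wdist (rs G Y) w a c + wdist (rs G Y) w c b ≤ wdist (rs G Y) w a b → c ∈ Z) :
    Rc (rs G Z) w a b (wdist (rs G Y) w a b) := by
  rcases (rc_wdist hw hr).cut (Z := Z) ha with h | ⟨c, hc, hc', ℓ₁, ℓ₂, h, h1, h2⟩
  · exact h
  · exact absurd (hZ c hc h1.reachable h2.reachable
      ((add_le_add (wdist_le hw h1) (wdist_le hw h2)).trans h)) hc'

end Restrict

/-- A walk enumerated by natural numbers. -/
lemma Rc.exists_seq (h : Rc A w a b ℓ) : ∃ (p : ℕ → V) (N : ℕ), p 0 = a ∧ p N = b ∧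
    (∀ i < N, A.Adj (p i) (p (i + 1))) ∧ ∑ i ∈ range N, w s(p i, p (i + 1)) ≤ ℓ := by
  obtain ⟨q, hq⟩ := h
  have key : ∀ {x y : V} (q : A.Walk x y), ∃ (p : ℕ → V) (N : ℕ), p 0 = x ∧ p N = y ∧
      (∀ i < N, A.Adj (p i) (p (i + 1))) ∧
      ∑ i ∈ range N, w s(p i, p (i + 1)) = wlen w q := by
    intro x y q
    induction q with
    | @nil u => exact ⟨fun _ => u, 0, by simp⟩
    | @cons u v z h q ih =>
      obtain ⟨p, N, h0, hN, hadj, hs⟩ := ih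
      refine ⟨fun i => Nat.casesOn i u p, N + 1, rfl, hN, ?_, ?_⟩
      · rintro (_ | i) hi
        · simpa [h0] using h
        · exact hadj i (by omega)
      · rw [sum_range_succ', wlen_cons, ← hs, add_comm]
        simp [h0]
  obtain ⟨p, N, h0, hN, hadj, hs⟩ := key q
  exact ⟨p, N, h0, hN, hadj, hs.le.trans hq⟩

lemma Rc.of_seq (p : ℕ → V) {i j : ℕ} (hij : i ≤ j)
    (h : ∀ l, i ≤ l → l < j → A.Adj (p l) (p (l + 1))) :
    Rc A w (p i) (p j) (∑ l ∈ Ico i j, w s(p l, p (l + 1))) := by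
  induction j, hij using Nat.le_induction with
  | base => exact Rc.refl (by simp)
  | succ j hij ih =>
    rw [sum_Ico_succ_top hij]
    exact (ih fun l h1 h2 => h l h1 (by omega)).trans (Rc.adj (h j hij (by omega)))

end Walks

section OneDim

variable {α : Type*}

lemma exists_sparse_piece (P : Finset α) (g : α → ℝ) (c h : ℝ) (hh : 0 < h) (K : ℕ) (hK : 0 < K) :
    ∃ i < K, (K : ℝ) * #{u ∈ P | c + i * h ≤ g u ∧ g u < c + i * h + h} ≤
      #{u ∈ P | c ≤ g u ∧ g u < c + K * h} := by
  by_contra! hcon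
  have hdisj : ∀ i ∈ range K, ∀ j ∈ range K, i ≠ j →
      Disjoint ({u ∈ P | c + i * h ≤ g u ∧ g u < c + i * h + h})
        ({u ∈ P | c + j * h ≤ g u ∧ g u < c + j * h + h}) := by
    have aux : ∀ i j : ℕ, i < j → ∀ x : ℝ, c + j * h ≤ x → x < c + i * h + h → False := by
      intro i j hij x h1 h2
      have : (i : ℝ) + 1 ≤ j := by exact_mod_cast hij
      nlinarith
    intro i _ j _ hij
    rw [disjoint_filter]
    rintro u - ⟨h1, h2⟩ ⟨h3, h4⟩
    rcases lt_or_gt_of_ne hij with h | h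
    · exact aux i j h _ h3 h2
    · exact aux j i h _ h1 h4
  have hsub : (range K).biUnion (fun i => {u ∈ P | c + i * h ≤ g u ∧ g u < c + i * h + h}) ⊆
      {u ∈ P | c ≤ g u ∧ g u < c + K * h} := by
    intro u hu
    simp only [mem_biUnion, mem_range, mem_filter] at hu ⊢
    obtain ⟨i, hi, hu, h1, h2⟩ := hu
    have : (i : ℝ) + 1 ≤ K := by exact_mod_cast hi
    have h0 : (0 : ℝ) ≤ i := by positivity
    exact ⟨hu, by nlinarith, by nlinarith⟩
  have hcard := card_le_card hsub
  rw [card_biUnion hdisj] at hcard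
  have h1 : (K : ℝ) * #{u ∈ P | c ≤ g u ∧ g u < c + K * h} <
      ∑ i ∈ range K, (K : ℝ) * #{u ∈ P | c + i * h ≤ g u ∧ g u < c + i * h + h} := by
    have : ∑ i ∈ range K, (#{u ∈ P | c ≤ g u ∧ g u < c + K * h} : ℝ) <
      ∑ i ∈ range K, (K : ℝ) * #{u ∈ P | c + i * h ≤ g u ∧ g u < c + i * h + h} :=
      sum_lt_sum_of_nonempty ⟨0, by simpa using hK⟩ fun i hi => hcon i (by simpa using hi)
    simpa using this
  rw [← mul_sum] at h1
  have h2 : (0 : ℝ) < K := by exact_mod_cast hK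
  have h3 := lt_of_mul_lt_mul_left h1 h2.le
  have h4 : ((∑ i ∈ range K, #{u ∈ P | c + i * h ≤ g u ∧ g u < c + i * h + h} : ℕ) : ℝ) ≤
    #{u ∈ P | c ≤ g u ∧ g u < c + K * h} := by exact_mod_cast hcard
  push_cast at h4
  linarith

lemma rpow_neg_le_of_le {x y : ℝ} (hx : 0 < x) (hxy : x ≤ y) :
    y ^ (-(3 / 4) : ℝ) ≤ x ^ (-(3 / 4) : ℝ) :=
  Real.rpow_le_rpow_of_nonpos hx hxy (by norm_num)

lemma div_rpow_neg_le {x : ℝ} (hx : 0 < x) :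
    (x / 1024) ^ (-(3 / 4) : ℝ) ≤ 256 * x ^ (-(3 / 4) : ℝ) := by
  rw [div_eq_mul_inv, mul_comm, Real.mul_rpow (by norm_num) hx.le]
  refine mul_le_mul_of_nonneg_right ?_ (by positivity)
  rw [Real.inv_rpow (by norm_num), Real.rpow_neg (by norm_num), inv_inv]
  calc (1024 : ℝ) ^ (3 / 4 : ℝ) ≤ 1024 ^ (4 / 5 : ℝ) :=
        Real.rpow_le_rpow_of_exponent_le (by norm_num) (by norm_num)
    _ = ((4 : ℝ) ^ (5 : ℝ)) ^ (4 / 5 : ℝ) := by norm_num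
    _ = 256 := by rw [← Real.rpow_mul (by norm_num)]; norm_num

lemma div_rpow_neg_eq {x : ℝ} (hx : 0 < x) :
    (x / 256) ^ (-(3 / 4) : ℝ) = 64 * x ^ (-(3 / 4) : ℝ) := by
  rw [div_eq_mul_inv, mul_comm, Real.mul_rpow (by norm_num) hx.le,
    Real.inv_rpow (by norm_num), Real.rpow_neg (by norm_num), inv_inv]
  congr 1
  calc (256 : ℝ) ^ (3 / 4 : ℝ) = ((4 : ℝ) ^ (4 : ℝ)) ^ (3 / 4 : ℝ) := by norm_num
    _ = 64 := by rw [← Real.rpow_mul (by norm_num)]; norm_num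

/-- A point of an interval at which the singular sum `∑ |g u - r| ^ (-3/4)` is
comparable to its average. -/
lemma exists_good_cut (P : Finset α) (g : α → ℝ) (N : ℕ) : ∀ c ℓ : ℝ, 0 < ℓ →
    #{u ∈ P | c ≤ g u ∧ g u < c + ℓ} = N →
    ∃ r, c + ℓ / 4 ≤ r ∧ r ≤ c + 3 * ℓ / 4 ∧ (∀ u ∈ P, g u ≠ r) ∧
      ∑ u ∈ P with (c ≤ g u ∧ g u < c + ℓ), |g u - r| ^ (-(3 / 4) : ℝ) ≤
        512 * N * ℓ ^ (-(3 / 4) : ℝ) := by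
  induction N using Nat.strong_induction_on with
  | _ N ih =>
    intro c ℓ hℓ hN
    rcases Nat.eq_zero_or_pos N with rfl | hpos
    · rw [card_eq_zero] at hN
      refine ⟨c + ℓ / 2, by linarith, by linarith, fun u hu h => ?_, by simp [hN]⟩
      have : u ∈ ({u ∈ P | c ≤ g u ∧ g u < c + ℓ} : Finset α) := by
        rw [mem_filter]; exact ⟨hu, by linarith, by linarith⟩
      simp [hN] at this
    · obtain ⟨i, hi, hcnt⟩ := exists_sparse_piece P g (c + ℓ / 4) (ℓ / 256) (by positivity) 128
        (by norm_num)
      set d := c + ℓ / 4 + i * (ℓ / 256) with hd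
      have hi' : (i : ℝ) + 1 ≤ 128 := by exact_mod_cast hi
      have hi0 : (0 : ℝ) ≤ i := by positivity
      have hd1 : c + ℓ / 4 ≤ d := by rw [hd]; nlinarith
      have hd2 : d + ℓ / 256 ≤ c + 3 * ℓ / 4 := by rw [hd]; nlinarith
      have hle : (#{u ∈ P | c + ℓ / 4 ≤ g u ∧ g u < c + ℓ / 4 + (128 : ℕ) * (ℓ / 256)} : ℝ) ≤ N := by
        rw [← hN]
        norm_cast
        refine card_le_card fun u hu => ?_
        rw [mem_filter] at hu ⊢
        obtain ⟨h0, h1, h2⟩ := hu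
        exact ⟨h0, by linarith, by linarith⟩
      set N' := #{u ∈ P | d ≤ g u ∧ g u < d + ℓ / 256} with hN'
      have hcnt' : (128 : ℝ) * N' ≤ N := by push_cast at hcnt; linarith
      have hlt : N' < N := by
        have h1 : (0 : ℝ) < N := by exact_mod_cast hpos
        have : (N' : ℝ) < N := by linarith [show (0 : ℝ) ≤ N' by positivity]
        exact_mod_cast this
      obtain ⟨r, hr1, hr2, hr3, hr4⟩ := ih N' hlt d (ℓ / 256) (by positivity) rfl
      refine ⟨r, by linarith, by linarith, hr3, ?_⟩
      rw [div_rpow_neg_eq hℓ] at hr4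
      have hsplit := sum_filter_add_sum_filter_not
        ({u ∈ P | c ≤ g u ∧ g u < c + ℓ} : Finset α) (fun u => d ≤ g u ∧ g u < d + ℓ / 256)
        (fun u => |g u - r| ^ (-(3 / 4) : ℝ))
      rw [← hsplit]
      have hin : ∑ u ∈ ({u ∈ P | c ≤ g u ∧ g u < c + ℓ} : Finset α) with
          (d ≤ g u ∧ g u < d + ℓ / 256), |g u - r| ^ (-(3 / 4) : ℝ) ≤
          512 * N' * (64 * ℓ ^ (-(3 / 4) : ℝ)) := by
        refine le_trans (sum_le_sum_of_subset_of_nonneg ?_ fun _ _ _ => by positivity) hr4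
        intro u hu
        simp only [mem_filter] at hu ⊢
        exact ⟨hu.1.1, hu.2⟩
      have hout : ∑ u ∈ ({u ∈ P | c ≤ g u ∧ g u < c + ℓ} : Finset α) with
          ¬ (d ≤ g u ∧ g u < d + ℓ / 256), |g u - r| ^ (-(3 / 4) : ℝ) ≤
          N * (256 * ℓ ^ (-(3 / 4) : ℝ)) := by
        refine le_trans (sum_le_card_nsmul _ _ (256 * ℓ ^ (-(3 / 4) : ℝ)) ?_) ?_
        · intro u hu
          rw [mem_filter] at hu
          refine le_trans (rpow_neg_le_of_le (by positivity) ?_) (div_rpow_neg_le hℓ)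
          by_cases h : d ≤ g u
          · have h2 : d + ℓ / 256 ≤ g u := by
              by_contra hc
              exact hu.2 ⟨h, not_le.mp hc⟩
            rw [le_abs]; left; linarith
          · rw [le_abs]; right; linarith
        · rw [nsmul_eq_mul]
          refine mul_le_mul_of_nonneg_right ?_ (by positivity)
          rw [← hN]
          exact_mod_cast card_filter_le _ _
      have hx : 0 ≤ ℓ ^ (-(3 / 4) : ℝ) := by positivity
      have := mul_le_mul_of_nonneg_right hcnt' hx
      nlinarith

end OneDim

section OneDim

variable {α : Type*}

lemma exists_scale (Y : Finset α) (g : α → ℝ) {b : ℝ} (hb : 0 < b) (h0 : ∃ u ∈ Y, g u ≤ 0)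
    (hhalf : 2 * #{u ∈ Y | g u ≤ b} ≤ #Y) :
    ∃ σ, 0 < σ ∧ 2 * σ ≤ b ∧ (σ / b) ^ 2 * #Y ≤ #{u ∈ Y | g u ≤ σ} ∧
      ∀ y, 2 * σ ≤ y → (#{u ∈ Y | g u ≤ y} : ℝ) ≤ 4 * (y / b) ^ 2 * #Y := by
  obtain ⟨u₀, hu₀, hgu₀⟩ := h0
  have hYpos : 0 < #Y := card_pos.mpr ⟨u₀, hu₀⟩
  have hex : ∃ j : ℕ, ((1 / 2 : ℝ) ^ j) ^ 2 * #Y ≤ #{u ∈ Y | g u ≤ b * (1 / 2) ^ j} := by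
    obtain ⟨j, hj⟩ := exists_pow_lt_of_lt_one (show (0 : ℝ) < 1 / #Y by positivity)
      (show (1 / 4 : ℝ) < 1 by norm_num)
    refine ⟨j, ?_⟩
    have h1 : ((1 / 2 : ℝ) ^ j) ^ 2 = (1 / 4) ^ j := by rw [← pow_mul, mul_comm, pow_mul]; norm_num
    rw [h1]
    have h2 : (1 / 4 : ℝ) ^ j * #Y ≤ 1 := by
      rw [lt_div_iff₀ (by positivity)] at hj; exact hj.le
    have h3 : 1 ≤ #{u ∈ Y | g u ≤ b * (1 / 2) ^ j} := by
      refine card_pos.mpr ⟨u₀, ?_⟩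
      rw [mem_filter]
      exact ⟨hu₀, hgu₀.trans (by positivity)⟩
    exact h2.trans (by exact_mod_cast h3)
  have hspec := Nat.find_spec hex
  have hmin : ∀ i < Nat.find hex,
      (#{u ∈ Y | g u ≤ b * (1 / 2) ^ i} : ℝ) ≤ ((1 / 2 : ℝ) ^ i) ^ 2 * #Y :=
    fun i hi => (not_le.mp (Nat.find_min hex hi)).le
  set j := Nat.find hex
  have hj : j ≠ 0 := by
    intro h
    rw [h] at hspec
    simp only [pow_zero, one_pow, one_mul, mul_one] at hspec
    have h1 : #Y ≤ #{u ∈ Y | g u ≤ b} := by exact_mod_cast hspec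
    omega
  obtain ⟨j', hj'⟩ := Nat.exists_eq_succ_of_ne_zero hj
  refine ⟨b * (1 / 2) ^ j, by positivity, ?_, ?_, ?_⟩
  · rw [hj', pow_succ]
    have : (1 / 2 : ℝ) ^ j' ≤ 1 := pow_le_one₀ (by norm_num) (by norm_num)
    nlinarith
  · rwa [mul_div_cancel_left₀ _ hb.ne']
  · have key : ∀ i ≤ j', ∀ y, b * (1 / 2) ^ i ≤ y →
        (#{u ∈ Y | g u ≤ y} : ℝ) ≤ 4 * (y / b) ^ 2 * #Y := by
      intro i hi
      induction i with
      | zero =>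
        intro y hy
        simp only [pow_zero, mul_one] at hy
        have h1 : 1 ≤ y / b := by rwa [one_le_div hb]
        have h2 : (#{u ∈ Y | g u ≤ y} : ℝ) ≤ #Y := by exact_mod_cast card_filter_le _ _
        nlinarith [show (0 : ℝ) ≤ #Y by positivity, mul_nonneg (show (0 : ℝ) ≤ #Y by positivity)
          (show 0 ≤ (y / b) ^ 2 - 1 by nlinarith)]
      | succ i ih =>
        intro y hy
        by_cases hy' : b * (1 / 2) ^ i ≤ y
        · exact ih (by omega) y hy'
        · have h1 : #{u ∈ Y | g u ≤ y} ≤ #{u ∈ Y | g u ≤ b * (1 / 2) ^ i} :=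
            card_le_card fun u hu => by
              rw [mem_filter] at hu ⊢
              exact ⟨hu.1, by linarith [hu.2]⟩
          have h2 := hmin i (by omega)
          have h3 : (1 / 2 : ℝ) ^ i ≤ 2 * (y / b) := by
            rw [← mul_div_assoc, le_div_iff₀ hb]
            rw [pow_succ] at hy
            linarith
          have h4 : ((1 / 2 : ℝ) ^ i) ^ 2 ≤ (2 * (y / b)) ^ 2 :=
            pow_le_pow_left₀ (by positivity) h3 2
          have h5 : (#{u ∈ Y | g u ≤ y} : ℝ) ≤ #{u ∈ Y | g u ≤ b * (1 / 2) ^ i} := by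
            exact_mod_cast h1
          have h6 := mul_le_mul_of_nonneg_right h4 (show (0 : ℝ) ≤ #Y by positivity)
          nlinarith
    intro y hy
    refine key j' le_rfl y (le_trans (le_of_eq ?_) hy)
    rw [hj', pow_succ]; ring

lemma exists_cut_aux (Y : Finset α) (g : α → ℝ) {b : ℝ} (hb : 0 < b) (h0 : ∃ u ∈ Y, g u ≤ 0)
    (hhalf : 2 * #{u ∈ Y | g u ≤ b} ≤ #Y) :
    ∃ r s : ℝ, 0 < r ∧ r < b ∧ 0 < s ∧ (∀ u ∈ Y, g u ≠ r) ∧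
      (∀ δ, s ≤ δ → (#{u ∈ Y | |g u - r| ≤ δ} : ℝ) ≤ 36 * (δ / b) ^ 2 * #Y) ∧
      (∑ u ∈ Y with |g u - r| ≤ s, |g u - r| ^ (-(3 / 4) : ℝ)) ^ 2 * b ^ (3 / 2 : ℝ) ≤
        2 * (516 * 36) ^ 2 * (#{u ∈ Y | g u ≤ r} * #{u ∈ Y | ¬ g u ≤ r}) := by
  obtain ⟨σ, hσ, hσb, hlow, hup⟩ := exists_scale Y g hb h0 hhalf
  obtain ⟨r, hr1, hr2, hr3, hr4⟩ := exists_good_cut Y g _ σ σ hσ rfl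
  refine ⟨r, σ, by linarith, by linarith, hσ, hr3, ?_, ?_⟩
  · intro δ hδ
    have h1 := hup (3 * δ) (by linarith)
    have h2 : (#{u ∈ Y | |g u - r| ≤ δ} : ℝ) ≤ #{u ∈ Y | g u ≤ 3 * δ} := by
      norm_cast
      refine card_le_card fun u hu => ?_
      rw [mem_filter] at hu ⊢
      exact ⟨hu.1, by linarith [(abs_le.mp hu.2).2]⟩
    refine h2.trans (h1.trans (le_of_eq ?_))
    ring
  · set S := ∑ u ∈ Y with |g u - r| ≤ σ, |g u - r| ^ (-(3 / 4) : ℝ) with hS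
    set x := σ / b with hx
    set m : ℝ := (#Y : ℝ) with hm
    have hx0 : 0 < x := by positivity
    have hx1 : x ≤ 1 := by rw [hx, div_le_one hb]; linarith
    have hm0 : 0 ≤ m := by positivity
    have hN : (#{u ∈ Y | g u ≤ 3 * σ} : ℝ) ≤ 36 * x ^ 2 * m := by
      refine (hup (3 * σ) (by linarith)).trans (le_of_eq ?_)
      rw [hx]; ring
    have hS0 : 0 ≤ S := sum_nonneg fun _ _ => by positivity
    have hSle : S ≤ 516 * (36 * x ^ 2 * m) * σ ^ (-(3 / 4) : ℝ) := by
      rw [hS, ← sum_filter_add_sum_filter_not _ (fun u => σ ≤ g u ∧ g u < σ + σ)]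
      have hin : ∑ u ∈ ({u ∈ Y | |g u - r| ≤ σ} : Finset α) with (σ ≤ g u ∧ g u < σ + σ),
          |g u - r| ^ (-(3 / 4) : ℝ) ≤ 512 * (36 * x ^ 2 * m) * σ ^ (-(3 / 4) : ℝ) := by
        refine le_trans (sum_le_sum_of_subset_of_nonneg (t := {u ∈ Y | σ ≤ g u ∧ g u < σ + σ}) ?_
          fun _ _ _ => by positivity) (hr4.trans ?_)
        · intro u hu
          simp only [mem_filter] at hu ⊢
          exact ⟨hu.1.1, hu.2⟩
        · refine mul_le_mul_of_nonneg_right (mul_le_mul_of_nonneg_left (le_trans ?_ hN)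
            (by norm_num)) (by positivity)
          norm_cast
          refine card_le_card fun u hu => ?_
          rw [mem_filter] at hu ⊢
          exact ⟨hu.1, by linarith [hu.2.2]⟩
      have hout : ∑ u ∈ ({u ∈ Y | |g u - r| ≤ σ} : Finset α) with ¬ (σ ≤ g u ∧ g u < σ + σ),
          |g u - r| ^ (-(3 / 4) : ℝ) ≤ (36 * x ^ 2 * m) * (4 * σ ^ (-(3 / 4) : ℝ)) := by
        refine le_trans (sum_le_card_nsmul _ _ (4 * σ ^ (-(3 / 4) : ℝ)) ?_) ?_
        · intro u hu
          rw [mem_filter] at hu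
          refine le_trans (rpow_neg_le_of_le (show 0 < σ / 4 by positivity) ?_) ?_
          · by_cases h : σ ≤ g u
            · have h2 : σ + σ ≤ g u := by
                by_contra hc
                exact hu.2 ⟨h, not_le.mp hc⟩
              rw [le_abs]; left; linarith
            · rw [le_abs]; right; linarith
          · rw [div_eq_mul_inv, mul_comm, Real.mul_rpow (by norm_num) hσ.le,
              Real.inv_rpow (by norm_num), Real.rpow_neg (by norm_num), inv_inv]
            refine mul_le_mul_of_nonneg_right ?_ (by positivity)
            calc (4 : ℝ) ^ (3 / 4 : ℝ) ≤ 4 ^ (1 : ℝ) :=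
                  Real.rpow_le_rpow_of_exponent_le (by norm_num) (by norm_num)
              _ = 4 := by norm_num
        · rw [nsmul_eq_mul]
          refine mul_le_mul_of_nonneg_right (le_trans ?_ hN) (by positivity)
          norm_cast
          refine card_le_card fun u hu => ?_
          simp only [mem_filter] at hu ⊢
          exact ⟨hu.1.1, by linarith [(abs_le.mp hu.1.2).2]⟩
      linarith
    have hsq : S ^ 2 ≤ (516 * (36 * x ^ 2 * m)) ^ 2 * σ ^ (-(3 / 2) : ℝ) := by
      refine (pow_le_pow_left₀ hS0 hSle 2).trans (le_of_eq ?_)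
      rw [mul_pow, ← Real.rpow_natCast (σ ^ (-(3 / 4) : ℝ)) 2, ← Real.rpow_mul hσ.le]
      norm_num
    have hxb : x ^ 2 * (σ ^ (-(3 / 2) : ℝ) * b ^ (3 / 2 : ℝ)) ≤ 1 := by
      have h1 : σ ^ (-(3 / 2) : ℝ) * b ^ (3 / 2 : ℝ) = x ^ (-(3 / 2) : ℝ) := by
        rw [hx, Real.div_rpow hσ.le hb.le, Real.rpow_neg hb.le, div_inv_eq_mul]
      rw [h1, ← Real.rpow_natCast, ← Real.rpow_add hx0]
      exact Real.rpow_le_one hx0.le hx1 (by norm_num)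
    have hk1 : x ^ 2 * m ≤ #{u ∈ Y | g u ≤ r} := by
      refine hlow.trans ?_
      norm_cast
      refine card_le_card fun u hu => ?_
      rw [mem_filter] at hu ⊢
      exact ⟨hu.1, by linarith [hu.2]⟩
    have hk2 : m ≤ 2 * #{u ∈ Y | ¬ g u ≤ r} := by
      have h1 := card_filter_add_card_filter_not (s := Y) (fun u => g u ≤ r)
      have h2 : #{u ∈ Y | g u ≤ r} ≤ #{u ∈ Y | g u ≤ b} := card_le_card fun u hu => by
        rw [mem_filter] at hu ⊢
        exact ⟨hu.1, by linarith [hu.2]⟩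
      rw [hm]
      norm_cast
      omega
    have hprod : x ^ 2 * m * m ≤ #{u ∈ Y | g u ≤ r} * (2 * #{u ∈ Y | ¬ g u ≤ r}) :=
      mul_le_mul hk1 hk2 hm0 (by positivity)
    have hb' : (0 : ℝ) ≤ b ^ (3 / 2 : ℝ) := by positivity
    calc S ^ 2 * b ^ (3 / 2 : ℝ)
        ≤ (516 * (36 * x ^ 2 * m)) ^ 2 * σ ^ (-(3 / 2) : ℝ) * b ^ (3 / 2 : ℝ) :=
          mul_le_mul_of_nonneg_right hsq hb'
      _ = (516 * 36) ^ 2 * (x ^ 2 * m * m) * (x ^ 2 * (σ ^ (-(3 / 2) : ℝ) * b ^ (3 / 2 : ℝ))) := by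
          ring
      _ ≤ (516 * 36) ^ 2 * (x ^ 2 * m * m) * 1 :=
          mul_le_mul_of_nonneg_left hxb (by positivity)
      _ ≤ _ := by linarith

/-- A threshold `r` for `g` around which few points of `Y` are close, with a sharper bound at
the smallest scales. -/
lemma exists_cut (Y : Finset α) (g : α → ℝ) {a : ℝ} (ha : 0 < a) (h0 : ∃ u ∈ Y, g u ≤ 0)
    (h1 : ∃ u ∈ Y, a ≤ g u) :
    ∃ r s : ℝ, 0 < r ∧ r < a ∧ 0 < s ∧ (∀ u ∈ Y, g u ≠ r) ∧
      (∀ δ, s ≤ δ → (#{u ∈ Y | |g u - r| ≤ δ} : ℝ) ≤ 576 * (δ / a) ^ 2 * #Y) ∧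
      (∑ u ∈ Y with |g u - r| ≤ s, |g u - r| ^ (-(3 / 4) : ℝ)) ^ 2 * (a / 4) ^ (3 / 2 : ℝ) ≤
        2 * (516 * 36) ^ 2 * (#{u ∈ Y | g u ≤ r} * #{u ∈ Y | ¬ g u ≤ r}) := by
  have hconv : ∀ δ : ℝ, 36 * (δ / (a / 4)) ^ 2 = 576 * (δ / a) ^ 2 := fun δ => by
    field_simp; ring
  by_cases hhalf : 2 * #{u ∈ Y | g u ≤ a / 4} ≤ #Y
  · obtain ⟨r, s, hr, hrb, hs, hne, hα, hβ⟩ := exists_cut_aux Y g (show 0 < a / 4 by positivity)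
      h0 hhalf
    simp only [hconv] at hα
    exact ⟨r, s, hr, by linarith, hs, hne, hα, hβ⟩
  · obtain ⟨r, s, hr, hrb, hs, hne, hα, hβ⟩ := exists_cut_aux Y (fun u => a - g u)
      (show 0 < a / 4 by positivity) (by obtain ⟨u, hu, h⟩ := h1; exact ⟨u, hu, by linarith⟩) (by
        have h2 := card_filter_add_card_filter_not (s := Y) (fun u => g u ≤ a / 4)
        have h3 : #{u ∈ Y | a - g u ≤ a / 4} ≤ #{u ∈ Y | ¬ g u ≤ a / 4} :=
          card_le_card fun u hu => by
            rw [mem_filter] at hu ⊢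
            exact ⟨hu.1, by linarith [hu.2]⟩
        omega)
    simp only [hconv] at hα
    have habs : ∀ u, |a - g u - r| = |g u - (a - r)| := fun u => by
      rw [← abs_neg]; congr 1; ring
    simp only [habs] at hα hβ
    refine ⟨a - r, s, by linarith, by linarith, hs, fun u hu h => hne u hu (by linarith), hα, ?_⟩
    have e1 : ({u ∈ Y | a - g u ≤ r} : Finset α) = {u ∈ Y | ¬ g u ≤ a - r} := by
      refine filter_congr fun u hu => ⟨fun h h' => hne u hu (by linarith), fun h => by linarith⟩
    have e2 : ({u ∈ Y | ¬ a - g u ≤ r} : Finset α) = {u ∈ Y | g u ≤ a - r} := by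
      refine filter_congr fun u hu => ⟨fun h => by linarith, fun h h' => hne u hu (by linarith)⟩
    rw [e1, e2] at hβ
    rw [mul_comm (#{u ∈ Y | g u ≤ a - r} : ℝ)]
    exact hβ

end OneDim

section Cost

variable {V : Type*} {G : SimpleGraph V} {w₀ : Sym2 V → ℝ}

/-- Ordered pairs of distinct vertices of `Y` with a `G`-geodesic inside `Y`. -/
noncomputable def surv (G : SimpleGraph V) (w₀ : Sym2 V → ℝ) (Y : Finset V) : Finset (V × V) :=
  Y.offDiag.filter fun e => Rc (rs G Y) w₀ e.1 e.2 (wdist G w₀ e.1 e.2)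

lemma mem_surv {Y : Finset V} {u v : V} : (u, v) ∈ surv G w₀ Y ↔
    (u ∈ Y ∧ v ∈ Y ∧ u ≠ v) ∧ Rc (rs G Y) w₀ u v (wdist G w₀ u v) := by
  simp [surv]

/-- Distortion estimates for a tree `T` on `Y`: outside an exceptional set `M` of pairs the
`3/2`-moment of the distortion is controlled, on `M` each vertex has few bad partners. -/
structure CostBound (G : SimpleGraph V) (w₀ : Sym2 V → ℝ) (Y : Finset V) (T : SimpleGraph V)
    (M : Finset (V × V)) : Prop where
  sub : M ⊆ surv G w₀ Y
  sum_le : ∑ e ∈ surv G w₀ Y \ M, (wdist T w₀ e.1 e.2 / wdist G w₀ e.1 e.2) ^ (3 / 2 : ℝ) ≤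
    2 ^ 14 * (516 * 36) ^ 2 * (#Y : ℝ) ^ 2
  count_le : ∀ u ∈ Y, ∀ x : ℝ, 0 < x →
    (#{v ∈ Y | (u, v) ∈ M ∧ wdist G w₀ u v ≤ x * wdist T w₀ u v} : ℝ) ≤
      576 * 256 ^ 2 * x ^ 2 * #Y

lemma near_term_le {d Δ D P Q : ℝ} (hd : 0 < d) (hD0 : 0 ≤ D) (hD : D ≤ 8 * Δ)
    (hP0 : 0 < P) (hQ0 : 0 < Q) (hP : P ≤ 4 * d) (hQ : Q ≤ 4 * d) :
    (D / d) ^ (3 / 2 : ℝ) ≤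
      (32 * Δ) ^ (3 / 2 : ℝ) * (P ^ (-(3 / 4) : ℝ) * Q ^ (-(3 / 4) : ℝ)) := by
  have h1 : (4 * d) ^ (-(3 / 4) : ℝ) ≤ P ^ (-(3 / 4) : ℝ) := rpow_neg_le_of_le hP0 hP
  have h2 : (4 * d) ^ (-(3 / 4) : ℝ) ≤ Q ^ (-(3 / 4) : ℝ) := rpow_neg_le_of_le hQ0 hQ
  have hΔ : 0 ≤ Δ := by linarith
  calc (D / d) ^ (3 / 2 : ℝ) ≤ ((32 * Δ) / (4 * d)) ^ (3 / 2 : ℝ) := by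
        refine Real.rpow_le_rpow (by positivity) ?_ (by norm_num)
        rw [div_le_div_iff₀ hd (by positivity)]
        nlinarith
    _ = (32 * Δ) ^ (3 / 2 : ℝ) * ((4 * d) ^ (-(3 / 4) : ℝ) * (4 * d) ^ (-(3 / 4) : ℝ)) := by
        rw [Real.div_rpow (by positivity) (by positivity), ← Real.rpow_add (by positivity),
          div_eq_mul_inv, ← Real.rpow_neg (by positivity)]
        norm_num
    _ ≤ _ := by
        refine mul_le_mul_of_nonneg_left (mul_le_mul h1 h2 (by positivity) (by positivity))
          (by positivity)

lemma rpow_const_le {Δ : ℝ} (hΔ : 0 < Δ) :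
    (32 * Δ) ^ (3 / 2 : ℝ) ≤ 2 ^ 14 * (Δ / 4 / 4) ^ (3 / 2 : ℝ) := by
  have : 32 * Δ = 512 * (Δ / 4 / 4) := by ring
  rw [this, Real.mul_rpow (by norm_num) (by positivity)]
  refine mul_le_mul_of_nonneg_right ?_ (by positivity)
  calc (512 : ℝ) ^ (3 / 2 : ℝ) = ((2 : ℝ) ^ (9 : ℝ)) ^ (3 / 2 : ℝ) := by norm_num
    _ = 2 ^ (27 / 2 : ℝ) := by rw [← Real.rpow_mul (by norm_num)]; norm_num
    _ ≤ 2 ^ (14 : ℝ) := Real.rpow_le_rpow_of_exponent_le (by norm_num) (by norm_num)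
    _ = 2 ^ 14 := by norm_num

variable [Fintype V]

/-- Distortion estimates are preserved when cutting along a well-chosen level of `pos`. -/
lemma CostBound.combine (hw : ∀ a b, G.Adj a b → 0 < w₀ s(a, b)) {Y : Finset V}
    {T T₁ T₂ : SimpleGraph V} {M₁ M₂ : Finset (V × V)} {Δ r s : ℝ} {pos : V → ℝ}
    (hTG : T ≤ G) (hT₁ : T₁ ≤ T) (hT₂ : T₂ ≤ T) (hΔ : 0 < Δ)
    (hdiam : ∀ u ∈ Y, ∀ v ∈ Y, wdist T w₀ u v ≤ 8 * Δ)
    (hpos : ∀ u ∈ Y, ∀ v ∈ Y, ∀ ℓ, Rc (rs G Y) w₀ u v ℓ → |pos u - pos v| ≤ 4 * ℓ)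
    (hne : ∀ u ∈ Y, pos u ≠ r)
    (hα : ∀ δ, s ≤ δ → (#{u ∈ Y | |pos u - r| ≤ δ} : ℝ) ≤ 576 * (δ / (Δ / 4)) ^ 2 * #Y)
    (hβ : (∑ u ∈ Y with |pos u - r| ≤ s, |pos u - r| ^ (-(3 / 4) : ℝ)) ^ 2 *
        (Δ / 4 / 4) ^ (3 / 2 : ℝ) ≤
        2 * (516 * 36) ^ 2 * (#{u ∈ Y | pos u ≤ r} * #{u ∈ Y | ¬ pos u ≤ r}))
    (h₁ : CostBound G w₀ {u ∈ Y | ¬ pos u ≤ r} T₁ M₁)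
    (h₂ : CostBound G w₀ {u ∈ Y | pos u ≤ r} T₂ M₂)
    (hc₁ : ∀ u ∈ Y, ¬ pos u ≤ r → ∀ v ∈ Y, ¬ pos v ≤ r → T₁.Reachable u v)
    (hc₂ : ∀ u ∈ Y, pos u ≤ r → ∀ v ∈ Y, pos v ≤ r → T₂.Reachable u v) :
    ∃ M, CostBound G w₀ Y T M := by
  set W : Finset V := {u ∈ Y | pos u ≤ r} with hW
  set Z : Finset V := {u ∈ Y | ¬ pos u ≤ r} with hZ
  have hWY : W ⊆ Y := filter_subset _ _
  have hZY : Z ⊆ Y := filter_subset _ _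
  have hcard : #W + #Z = #Y := card_filter_add_card_filter_not _
  have hG : NonnegOn G w₀ := fun a b h => (hw a b h).le
  have hTn : NonnegOn T w₀ := hG.mono hTG
  have hle₁ : ∀ u ∈ Z, ∀ v ∈ Z, wdist T w₀ u v ≤ wdist T₁ w₀ u v := fun u hu v hv =>
    wdist_le hTn ((rc_wdist (hTn.mono hT₁) (hc₁ u (mem_filter.mp hu).1 (mem_filter.mp hu).2 v
      (mem_filter.mp hv).1 (mem_filter.mp hv).2)).mono hT₁)
  have hle₂ : ∀ u ∈ W, ∀ v ∈ W, wdist T w₀ u v ≤ wdist T₂ w₀ u v := fun u hu v hv =>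
    wdist_le hTn ((rc_wdist (hTn.mono hT₂) (hc₂ u (mem_filter.mp hu).1 (mem_filter.mp hu).2 v
      (mem_filter.mp hv).1 (mem_filter.mp hv).2)).mono hT₂)
  have hsW : surv G w₀ W ⊆ surv G w₀ Y := by
    rintro ⟨u, v⟩ h
    rw [mem_surv] at h ⊢
    exact ⟨⟨hWY h.1.1, hWY h.1.2.1, h.1.2.2⟩, h.2.mono (rs_mono hWY)⟩
  have hsZ : surv G w₀ Z ⊆ surv G w₀ Y := by
    rintro ⟨u, v⟩ h
    rw [mem_surv] at h ⊢
    exact ⟨⟨hZY h.1.1, hZY h.1.2.1, h.1.2.2⟩, h.2.mono (rs_mono hZY)⟩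
  have hrn : NonnegOn (rs G Y) w₀ := hG.mono rs_le
  have hdpos : ∀ u v, (u, v) ∈ surv G w₀ Y → 0 < wdist G w₀ u v := fun u v h => by
    rw [mem_surv] at h
    exact wdist_pos hw (h.2.mono rs_le).reachable h.1.2.2
  have hside : ∀ u v, (u, v) ∈ surv G w₀ Y → (u, v) ∉ surv G w₀ W → (u, v) ∉ surv G w₀ Z →
      |pos u - r| ≤ 4 * wdist G w₀ u v := by
    intro u v h hnW hnZ
    rw [mem_surv] at h
    obtain ⟨⟨hu, hv, huv⟩, hR⟩ := h
    have hup : ∃ c ∈ Y, pos c ≤ r ∧ |pos u - pos c| ≤ 4 * wdist G w₀ u v := by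
      by_cases huW : pos u ≤ r
      · exact ⟨u, hu, huW, by simpa using (wdist_nonneg hG)⟩
      · rcases hR.cut (Z := Z) hu with h | ⟨c, hc, hcZ, ℓ₁, ℓ₂, h12, h1, h2⟩
        · refine absurd ?_ hnZ
          have huZ : u ∈ Z := mem_filter.mpr ⟨hu, huW⟩
          exact mem_surv.mpr ⟨⟨huZ, h.mem_rs huZ, huv⟩, h⟩
        · refine ⟨c, hc, by_contra fun h => hcZ (mem_filter.mpr ⟨hc, h⟩), ?_⟩
          have := hpos u hu c hc ℓ₁ h1
          have := h2.nonneg hrn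
          linarith
    have hdn : ∃ c ∈ Y, ¬ pos c ≤ r ∧ |pos u - pos c| ≤ 4 * wdist G w₀ u v := by
      by_cases huW : pos u ≤ r
      · rcases hR.cut (Z := W) hu with h | ⟨c, hc, hcZ, ℓ₁, ℓ₂, h12, h1, h2⟩
        · refine absurd ?_ hnW
          have huZ : u ∈ W := mem_filter.mpr ⟨hu, huW⟩
          exact mem_surv.mpr ⟨⟨huZ, h.mem_rs huZ, huv⟩, h⟩
        · refine ⟨c, hc, fun h => hcZ (mem_filter.mpr ⟨hc, h⟩), ?_⟩
          have := hpos u hu c hc ℓ₁ h1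
          have := h2.nonneg hrn
          linarith
      · exact ⟨u, hu, huW, by simpa using (wdist_nonneg hG)⟩
    obtain ⟨c, -, hc, hc'⟩ := hup
    obtain ⟨e, -, he, he'⟩ := hdn
    rw [abs_le] at hc' he' ⊢
    exact ⟨by linarith [hc'.1, not_le.mp he], by linarith [hc'.2]⟩
  have hswap : ∀ (X : Finset V) u v, (u, v) ∈ surv G w₀ X → (v, u) ∈ surv G w₀ X := by
    intro X u v h
    rw [mem_surv] at h ⊢
    exact ⟨⟨h.1.2.1, h.1.1, h.1.2.2.symm⟩, by rw [wdist_comm]; exact h.2.symm⟩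
  have hside' : ∀ u v, (u, v) ∈ surv G w₀ Y → (u, v) ∉ surv G w₀ W → (u, v) ∉ surv G w₀ Z →
      |pos v - r| ≤ 4 * wdist G w₀ u v := by
    intro u v h h1 h2
    rw [wdist_comm]
    exact hside v u (hswap _ _ _ h) (fun h => h1 (hswap _ _ _ h)) (fun h => h2 (hswap _ _ _ h))
  set Mid : Finset (V × V) := {e ∈ surv G w₀ Y | e ∉ surv G w₀ W ∧ e ∉ surv G w₀ Z ∧
    ¬ 4 * wdist G w₀ e.1 e.2 < s} with hMid
  set Near : Finset (V × V) := {e ∈ surv G w₀ Y | e ∉ surv G w₀ W ∧ e ∉ surv G w₀ Z ∧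
    4 * wdist G w₀ e.1 e.2 < s} with hNear
  refine ⟨M₁ ∪ M₂ ∪ Mid, ?_, ?_, ?_⟩
  · exact union_subset (union_subset (h₁.sub.trans hsZ) (h₂.sub.trans hsW)) (filter_subset _ _)
  · have hsub : surv G w₀ Y \ (M₁ ∪ M₂ ∪ Mid) ⊆
        ((surv G w₀ Z \ M₁) ∪ (surv G w₀ W \ M₂)) ∪ Near := by
      intro e he
      simp only [hMid, hNear, mem_sdiff, mem_union, mem_filter, not_or, not_and] at he ⊢
      tauto
    set f : V × V → ℝ := fun e => (wdist T w₀ e.1 e.2 / wdist G w₀ e.1 e.2) ^ (3 / 2 : ℝ) with hf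
    have hdiv : ∀ e : V × V, 0 ≤ wdist T w₀ e.1 e.2 / wdist G w₀ e.1 e.2 := fun e =>
      div_nonneg (wdist_nonneg hTn) (wdist_nonneg hG)
    have hf0 : ∀ e, 0 ≤ f e := fun e => Real.rpow_nonneg (hdiv e) _
    have hs1 : ∑ e ∈ surv G w₀ Z \ M₁, f e ≤ 2 ^ 14 * (516 * 36) ^ 2 * (#Z : ℝ) ^ 2 := by
      refine (sum_le_sum fun e he => ?_).trans h₁.sum_le
      obtain ⟨u, v⟩ := e
      have := (mem_surv.mp (mem_sdiff.mp he).1).1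
      exact Real.rpow_le_rpow (hdiv _) (div_le_div_of_nonneg_right (hle₁ u this.1 v this.2.1)
        (wdist_nonneg hG)) (by norm_num)
    have hs2 : ∑ e ∈ surv G w₀ W \ M₂, f e ≤ 2 ^ 14 * (516 * 36) ^ 2 * (#W : ℝ) ^ 2 := by
      refine (sum_le_sum fun e he => ?_).trans h₂.sum_le
      obtain ⟨u, v⟩ := e
      have := (mem_surv.mp (mem_sdiff.mp he).1).1
      exact Real.rpow_le_rpow (hdiv _) (div_le_div_of_nonneg_right (hle₂ u this.1 v this.2.1)
        (wdist_nonneg hG)) (by norm_num)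
    have hs3 : ∑ e ∈ Near, f e ≤ 2 ^ 14 * (516 * 36) ^ 2 * (2 * (#W * #Z)) := by
      set win : Finset V := {u ∈ Y | |pos u - r| ≤ s} with hwin
      set P : V → ℝ := fun u => |pos u - r| ^ (-(3 / 4) : ℝ) with hP
      have hNs : Near ⊆ win ×ˢ win := by
        rintro ⟨u, v⟩ he
        rw [hNear, mem_filter] at he
        have := (mem_surv.mp he.1).1
        rw [mem_product, hwin, mem_filter, mem_filter]
        have h1 := hside u v he.1 he.2.1 he.2.2.1
        have h2 := hside' u v he.1 he.2.1 he.2.2.1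
        have h3 := he.2.2.2
        simp only at h3
        exact ⟨⟨this.1, by linarith⟩, ⟨this.2.1, by linarith⟩⟩
      have h1 : ∑ e ∈ Near, f e ≤ ∑ e ∈ Near, (32 * Δ) ^ (3 / 2 : ℝ) * (P e.1 * P e.2) := by
        refine sum_le_sum ?_
        rintro ⟨u, v⟩ he
        rw [hNear, mem_filter] at he
        have := (mem_surv.mp he.1).1
        exact near_term_le (hdpos u v he.1) (wdist_nonneg hTn) (hdiam u this.1 v this.2.1)
          (abs_pos.mpr (sub_ne_zero.mpr (hne u this.1)))
          (abs_pos.mpr (sub_ne_zero.mpr (hne v this.2.1)))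
          (hside u v he.1 he.2.1 he.2.2.1) (hside' u v he.1 he.2.1 he.2.2.1)
      have h2 : ∑ e ∈ Near, (32 * Δ) ^ (3 / 2 : ℝ) * (P e.1 * P e.2) ≤
          ∑ e ∈ win ×ˢ win, (32 * Δ) ^ (3 / 2 : ℝ) * (P e.1 * P e.2) :=
        sum_le_sum_of_subset_of_nonneg hNs fun _ _ _ => by positivity
      have h3 : ∑ e ∈ win ×ˢ win, (32 * Δ) ^ (3 / 2 : ℝ) * (P e.1 * P e.2) =
          (32 * Δ) ^ (3 / 2 : ℝ) * (∑ u ∈ win, P u) ^ 2 := by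
        rw [← mul_sum, sum_product, sq, sum_mul_sum]
      have h4 := mul_le_mul_of_nonneg_right (rpow_const_le hΔ) (sq_nonneg (∑ u ∈ win, P u))
      nlinarith
    have hWZ : (#Y : ℝ) = #W + #Z := by exact_mod_cast hcard.symm
    calc ∑ e ∈ surv G w₀ Y \ (M₁ ∪ M₂ ∪ Mid), f e
        ≤ ∑ e ∈ ((surv G w₀ Z \ M₁) ∪ (surv G w₀ W \ M₂)) ∪ Near, f e :=
          sum_le_sum_of_subset_of_nonneg hsub fun e _ _ => hf0 e
      _ ≤ (∑ e ∈ surv G w₀ Z \ M₁, f e + ∑ e ∈ surv G w₀ W \ M₂, f e) + ∑ e ∈ Near, f e := by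
          have hu : ∀ A B : Finset (V × V), ∑ e ∈ A ∪ B, f e ≤ ∑ e ∈ A, f e + ∑ e ∈ B, f e :=
            fun A B => by
              rw [← sum_union_inter]
              linarith [sum_nonneg (s := A ∩ B) fun e _ => hf0 e]
          linarith [hu ((surv G w₀ Z \ M₁) ∪ (surv G w₀ W \ M₂)) Near,
            hu (surv G w₀ Z \ M₁) (surv G w₀ W \ M₂)]
      _ ≤ _ := by rw [hWZ]; nlinarith
  · intro u hu x hx
    by_cases hmid : ∃ v, (u, v) ∈ Mid ∧ wdist G w₀ u v ≤ x * wdist T w₀ u v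
    · obtain ⟨v', hv', hvx⟩ := hmid
      rw [hMid, mem_filter] at hv'
      have hv'Y := (mem_surv.mp hv'.1).1
      have hsm : s ≤ 4 * wdist G w₀ u v' := not_lt.mp hv'.2.2.2
      have h1 := hdiam u hu v' hv'Y.2.1
      have h2 := mul_le_mul_of_nonneg_left h1 hx.le
      have h3 := hside u v' hv'.1 hv'.2.1 hv'.2.2.1
      have h4 := hα (64 * (x * Δ)) (by nlinarith [mul_pos hx hΔ])
      have h5 : 576 * (64 * (x * Δ) / (Δ / 4)) ^ 2 * (#Y : ℝ) = 576 * 256 ^ 2 * x ^ 2 * #Y := by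
        field_simp; ring
      rw [← h5]
      refine le_trans ?_ h4
      norm_cast
      refine card_le_card fun v hv => ?_
      rw [mem_filter] at hv ⊢
      obtain ⟨hvY, hvM, hvd⟩ := hv
      have hs : (u, v) ∈ surv G w₀ Y := by
        simp only [mem_union] at hvM
        rcases hvM with (h | h) | h
        · exact hsZ (h₁.sub h)
        · exact hsW (h₂.sub h)
        · exact (mem_filter.mp h).1
      have h6 := hpos u hu v hvY _ (mem_surv.mp hs).2
      have h7 := mul_le_mul_of_nonneg_left (hdiam u hu v hvY) hx.le
      refine ⟨hvY, ?_⟩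
      have h8 : |pos v - r| ≤ |pos u - r| + |pos u - pos v| := by
        rw [show pos v - r = (pos u - r) - (pos u - pos v) by ring]
        exact abs_sub _ _
      linarith
    · push Not at hmid
      by_cases huW : pos u ≤ r
      · have h3 := h₂.count_le u (mem_filter.mpr ⟨hu, huW⟩) x hx
        refine le_trans ?_ (h3.trans (mul_le_mul_of_nonneg_left
          (by exact_mod_cast card_le_card hWY) (by positivity)))
        norm_cast
        refine card_le_card fun v hv => ?_
        rw [mem_filter] at hv ⊢
        obtain ⟨hvY, hvM, hvd⟩ := hv
        simp only [mem_union] at hvM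
        rcases hvM with (h | h) | h
        · exact absurd huW (mem_filter.mp (mem_surv.mp (h₁.sub h)).1.1).2
        · have hm := (mem_surv.mp (h₂.sub h)).1
          exact ⟨hm.2.1, h, hvd.trans (mul_le_mul_of_nonneg_left (hle₂ u hm.1 v hm.2.1) hx.le)⟩
        · exact absurd hvd (not_le.mpr (hmid v h))
      · have h3 := h₁.count_le u (mem_filter.mpr ⟨hu, huW⟩) x hx
        refine le_trans ?_ (h3.trans (mul_le_mul_of_nonneg_left
          (by exact_mod_cast card_le_card hZY) (by positivity)))
        norm_cast
        refine card_le_card fun v hv => ?_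
        rw [mem_filter] at hv ⊢
        obtain ⟨hvY, hvM, hvd⟩ := hv
        simp only [mem_union] at hvM
        rcases hvM with (h | h) | h
        · have hm := (mem_surv.mp (h₁.sub h)).1
          exact ⟨hm.2.1, h, hvd.trans (mul_le_mul_of_nonneg_left (hle₁ u hm.1 v hm.2.1) hx.le)⟩
        · exact absurd (mem_filter.mp (mem_surv.mp (h₂.sub h)).1.1).2 huW
        · exact absurd hvd (not_le.mpr (hmid v h))

end Cost

section Petal

variable {V : Type*} [Fintype V] {G : SimpleGraph V} {w : Sym2 V → ℝ}

/-- Weight of the first `i` steps of the vertex sequence `p`. -/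
noncomputable def pre (w : Sym2 V → ℝ) (p : ℕ → V) (i : ℕ) : ℝ :=
  ∑ l ∈ range i, w s(p l, p (l + 1))

omit [Fintype V] in
lemma pre_zero (p : ℕ → V) : pre w p 0 = 0 := by simp [pre]

omit [Fintype V] in
lemma pre_succ (p : ℕ → V) (i : ℕ) : pre w p (i + 1) = pre w p i + w s(p i, p (i + 1)) := by
  simp [pre, sum_range_succ]

omit [Fintype V] in
lemma pre_rc {A : SimpleGraph V} (p : ℕ → V) {i j : ℕ} (hij : i ≤ j)
    (h : ∀ l, i ≤ l → l < j → A.Adj (p l) (p (l + 1))) :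
    Rc A w (p i) (p j) (pre w p j - pre w p i) := by
  have := Rc.of_seq (w := w) p hij h
  rwa [sum_Ico_eq_sub _ hij] at this

omit [Fintype V] in
lemma pre_mono {A : SimpleGraph V} (hw : NonnegOn A w) (p : ℕ → V) {i j : ℕ} (hij : i ≤ j)
    (h : ∀ l, i ≤ l → l < j → A.Adj (p l) (p (l + 1))) : pre w p i ≤ pre w p j := by
  have := (pre_rc (w := w) p hij h).nonneg hw
  linarith

omit [Fintype V] in
lemma pre_shift (p : ℕ → V) (j i : ℕ) :
    pre w (fun l => p (j + l)) i = pre w p (j + i) - pre w p j := by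
  have h := sum_range_add (fun l => w s(p l, p (l + 1))) j i
  simp only [pre, add_assoc] at h ⊢
  linarith

variable {Y : Finset V} {x₀ : V} {p : ℕ → V} {N : ℕ}

/-- The petal function: its sublevel sets are petals around the endpoint of the geodesic `p`. -/
lemma exists_petal (hw : NonnegOn (rs G Y) w) (hx₀ : x₀ ∈ Y)
    (hconn : ∀ z ∈ Y, (rs G Y).Reachable x₀ z) (hp0 : p 0 = x₀)
    (hadj : ∀ i < N, (rs G Y).Adj (p i) (p (i + 1)))
    (hshort : ∀ i ≤ N, wdist (rs G Y) w x₀ (p i) = pre w p i) :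
    ∃ pos : V → ℝ,
      (∀ z ∈ Y, pre w p N - wdist (rs G Y) w x₀ z ≤ pos z) ∧
      (∀ i ≤ N, pos (p i) = pre w p N - pre w p i) ∧
      (∀ u ∈ Y, ∀ v ∈ Y, |pos u - pos v| ≤ 4 * wdist (rs G Y) w u v) ∧
      (∀ r, ∀ z ∈ Y, ¬ pos z ≤ r →
        Rc (rs G {u ∈ Y | ¬ pos u ≤ r}) w x₀ z (wdist (rs G Y) w x₀ z)) ∧
      (∀ r, ∀ z ∈ Y, pos z ≤ r → ∃ i ≤ N, pre w p N - pre w p i ≤ r ∧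
        ∃ ℓ, Rc (rs G {u ∈ Y | pos u ≤ r}) w (p i) z ℓ ∧
          2 * ℓ ≤ r - pre w p N - pre w p i + 2 * wdist (rs G Y) w x₀ z) := by
  set d := wdist (rs G Y) w with hd
  have hpY : ∀ i ≤ N, p i ∈ Y := by
    intro i hi
    cases i with
    | zero => rwa [hp0]
    | succ i => exact (hadj i (by omega)).2.2
  have hreach : ∀ u ∈ Y, ∀ v ∈ Y, (rs G Y).Reachable u v :=
    fun u hu v hv => (hconn u hu).symm.trans (hconn v hv)
  have htri : ∀ a ∈ Y, ∀ b ∈ Y, ∀ c ∈ Y, d a c ≤ d a b + d b c := fun a ha b hb c hc =>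
    wdist_triangle hw (hreach a ha b hb) (hreach b hb c hc)
  have hcomm : ∀ a b, d a b = d b a := fun a b => wdist_comm _ _ a b
  have hne : (range (N + 1)).Nonempty := ⟨0, by simp⟩
  set F : V → ℕ → ℝ := fun z i => pre w p N + pre w p i + 2 * d (p i) z - 2 * d x₀ z with hF
  set pos : V → ℝ := fun z => (range (N + 1)).inf' hne (F z) with hpos
  have hle : ∀ z, ∀ i ≤ N, pos z ≤ F z i := fun z i hi => inf'_le _ (by simp; omega)
  have hatt : ∀ z, ∃ i ≤ N, pos z = F z i := fun z => by
    obtain ⟨i, hi, h⟩ := exists_mem_eq_inf' hne (F z)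
    exact ⟨i, by simp at hi; omega, h⟩
  have hP1 : ∀ z ∈ Y, pre w p N - d x₀ z ≤ pos z := by
    intro z hz
    obtain ⟨i, hi, h⟩ := hatt z
    rw [h, hF]
    have h1 := htri x₀ hx₀ (p i) (hpY i hi) z hz
    rw [show d x₀ (p i) = pre w p i from hshort i hi] at h1
    have h2 : 0 ≤ d (p i) z := wdist_nonneg hw
    simp only
    linarith
  have hP3 : ∀ u ∈ Y, ∀ v ∈ Y, pos u ≤ pos v + 4 * d u v := by
    intro u hu v hv
    obtain ⟨i, hi, h⟩ := hatt v
    have h1 := hle u i hi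
    rw [h]
    simp only [hF] at h1 ⊢
    have h2 := htri (p i) (hpY i hi) v hv u hu
    have h3 := htri x₀ hx₀ u hu v hv
    rw [hcomm v u] at h2
    linarith
  refine ⟨pos, hP1, ?_, ?_, ?_, ?_⟩
  · intro i hi
    have h1 := hP1 (p i) (hpY i hi)
    have h2 := hle (p i) i hi
    simp only [hF] at h2
    rw [show d x₀ (p i) = pre w p i from hshort i hi] at h1 h2
    rw [show d (p i) (p i) = 0 from wdist_self hw] at h2
    linarith
  · intro u hu v hv
    rw [abs_le]
    have h1 := hP3 u hu v hv
    have h2 := hP3 v hv u hu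
    rw [hcomm v u] at h2
    exact ⟨by linarith, by linarith⟩
  · intro r z hz hzr
    refine Rc.restrict hw hx₀ (hconn z hz) fun c hc _ _ h => ?_
    refine mem_filter.mpr ⟨hc, fun hcr => hzr ?_⟩
    obtain ⟨i, hi, h'⟩ := hatt c
    have h1 := hle z i hi
    rw [h'] at hcr
    simp only [hF] at h1 hcr
    have h2 := htri (p i) (hpY i hi) c hc z hz
    simp only [hd] at h1 h2 hcr
    linarith
  · intro r z hz hzr
    obtain ⟨i, hi, h'⟩ := hatt z
    have key : ∀ c ∈ Y, d (p i) c + d c z ≤ d (p i) z → pos c ≤ r := by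
      intro c hc hcz
      refine le_trans ?_ hzr
      rw [h']
      have h1 := hle c i hi
      simp only [hF] at h1 ⊢
      have h2 := htri x₀ hx₀ c hc z hz
      linarith
    have hself : pos (p i) ≤ r := key (p i) (hpY i hi) (by
      rw [show d (p i) (p i) = 0 from wdist_self hw, zero_add])
    refine ⟨i, hi, ?_, d (p i) z, ?_, ?_⟩
    · have h1 := hP1 (p i) (hpY i hi)
      rw [show d x₀ (p i) = pre w p i from hshort i hi] at h1
      linarith
    · exact Rc.restrict hw (hpY i hi) (hreach _ (hpY i hi) z hz) fun c hc _ _ h =>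
        mem_filter.mpr ⟨hc, key c hc h⟩
    · rw [h'] at hzr
      simp only [hF] at hzr
      linarith

end Petal

section Join

variable {V : Type*} {G : SimpleGraph V}

lemma exists_join {Y : Finset V} {P : V → Prop} {T₁ T₂ : SimpleGraph V} {x y : V}
    (h₁ : T₁ ≤ rs G {u ∈ Y | ¬ P u}) (h₂ : T₂ ≤ rs G {u ∈ Y | P u})
    (hc₁ : T₁.edgeSet.ncard + 1 ≤ #{u ∈ Y | ¬ P u}) (hc₂ : T₂.edgeSet.ncard + 1 ≤ #{u ∈ Y | P u})
    (hyx : (rs G Y).Adj y x) :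
    ∃ T : SimpleGraph V, T ≤ rs G Y ∧ T₁ ≤ T ∧ T₂ ≤ T ∧ T.Adj y x ∧ T.edgeSet.ncard + 1 ≤ #Y := by
  refine ⟨T₁ ⊔ T₂ ⊔ SimpleGraph.edge y x, ?_, le_sup_left.trans le_sup_left,
    le_sup_right.trans le_sup_left, ?_, ?_⟩
  · refine sup_le (sup_le (h₁.trans (rs_mono (filter_subset _ _)))
      (h₂.trans (rs_mono (filter_subset _ _)))) ?_
    intro a b hab
    rw [SimpleGraph.edge_adj] at hab
    rcases hab.1 with ⟨rfl, rfl⟩ | ⟨rfl, rfl⟩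
    exacts [hyx, hyx.symm]
  · exact Or.inr (by rw [SimpleGraph.edge_adj]; exact ⟨.inl ⟨rfl, rfl⟩, hyx.1.ne⟩)
  · rw [SimpleGraph.edgeSet_sup, SimpleGraph.edgeSet_sup,
      SimpleGraph.edgeSet_edge_of_ne hyx.1.ne]
    have h3 := Set.ncard_union_le (T₁.edgeSet ∪ T₂.edgeSet) {s(y, x)}
    have h4 := Set.ncard_union_le T₁.edgeSet T₂.edgeSet
    rw [Set.ncard_singleton] at h3
    have h5 : #{u ∈ Y | P u} + #{u ∈ Y | ¬ P u} = #Y := card_filter_add_card_filter_not _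
    omega

end Join

section Induction

variable {V : Type*} {G : SimpleGraph V} {w₀ w : Sym2 V → ℝ}

/-- The invariant of the petal recursion: `p` is a geodesic of `Y` issuing from `x₀`, and the
weights `w` equal `w₀` off `p` and are at least `w₀ / 2` on it. -/
structure PetalState (G : SimpleGraph V) (w₀ w : Sym2 V → ℝ) (Y : Finset V) (x₀ : V) (p : ℕ → V)
    (N : ℕ) : Prop where
  mem : x₀ ∈ Y
  conn : ∀ z ∈ Y, (rs G Y).Reachable x₀ z
  wpos : ∀ a b, (rs G Y).Adj a b → 0 < w s(a, b)
  wle : ∀ a b, (rs G Y).Adj a b → w s(a, b) ≤ w₀ s(a, b)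
  lew : ∀ a b, (rs G Y).Adj a b → w₀ s(a, b) ≤ 2 * w s(a, b)
  start : p 0 = x₀
  adj : ∀ i < N, (rs G Y).Adj (p i) (p (i + 1))
  short : ∀ i ≤ N, wdist (rs G Y) w x₀ (p i) = pre w p i
  full : ∀ a b, (rs G Y).Adj a b → (∀ i < N, s(a, b) ≠ s(p i, p (i + 1))) → w s(a, b) = w₀ s(a, b)

/-- A tree on `Y` with small radius from `x₀` and small stretch along `p`. -/
structure PetalTree (G : SimpleGraph V) (w₀ w : Sym2 V → ℝ) (Y : Finset V) (x₀ : V) (p : ℕ → V)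
    (N : ℕ) (T : SimpleGraph V) : Prop where
  le : T ≤ rs G Y
  card : T.edgeSet.ncard + 1 ≤ #Y
  rad : ∀ z ∈ Y, Rc T w₀ x₀ z (4 * wdist (rs G Y) w x₀ z)
  path : Rc T w₀ x₀ (p N) (2 * pre w p N)

lemma PetalState.nonneg {Y : Finset V} {x₀ : V} {p : ℕ → V} {N : ℕ}
    (S : PetalState G w₀ w Y x₀ p N) : NonnegOn (rs G Y) w := fun a b h => (S.wpos a b h).le

variable [Fintype V]

lemma short_of_le {A B : SimpleGraph V} (hAB : A ≤ B) (hB : NonnegOn B w) {p : ℕ → V} {N : ℕ}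
    (hadj : ∀ i < N, A.Adj (p i) (p (i + 1)))
    (h : ∀ i ≤ N, pre w p i ≤ wdist B w (p 0) (p i)) :
    ∀ i ≤ N, wdist A w (p 0) (p i) = pre w p i := by
  intro i hi
  have h1 : Rc A w (p 0) (p i) (pre w p i - pre w p 0) :=
    pre_rc p (Nat.zero_le i) fun l _ hl => hadj l (by omega)
  rw [pre_zero, sub_zero] at h1
  refine le_antisymm (wdist_le (hB.mono hAB) h1) ((h i hi).trans ?_)
  exact wdist_le hB ((rc_wdist (hB.mono hAB) h1.reachable).mono hAB)

/-- The data produced by one petal cut: trees on the two sides that glue to a tree on `Y`. -/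
def SplitTrees (G : SimpleGraph V) (w₀ w : Sym2 V → ℝ) (Y : Finset V) (x₀ : V) (p : ℕ → V) (N : ℕ)
    (W Z : Finset V) (y x : V) : Prop :=
  ∃ T₁ T₂ M₁ M₂, T₁ ≤ rs G Z ∧ T₂ ≤ rs G W ∧ T₁.edgeSet.ncard + 1 ≤ #Z ∧
    T₂.edgeSet.ncard + 1 ≤ #W ∧ CostBound G w₀ Z T₁ M₁ ∧ CostBound G w₀ W T₂ M₂ ∧
    (∀ z ∈ Z, T₁.Reachable x₀ z) ∧ (∀ z ∈ W, T₂.Reachable x z) ∧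
    ∀ T, T₁ ≤ T → T₂ ≤ T → T.Adj y x →
      (∀ z ∈ Y, Rc T w₀ x₀ z (4 * wdist (rs G Y) w x₀ z)) ∧ Rc T w₀ x₀ (p N) (2 * pre w p N)

/-- The recursion hypothesis for proper subsets of `Y`. -/
def PetalIH (G : SimpleGraph V) (w₀ : Sym2 V → ℝ) (Y : Finset V) : Prop :=
  ∀ Y' : Finset V, #Y' < #Y → ∀ w x₀ p N, PetalState G w₀ w Y' x₀ p N →
    ∃ T M, PetalTree G w₀ w Y' x₀ p N T ∧ CostBound G w₀ Y' T M

section Split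

variable {Y W Z : Finset V} {x₀ : V} {p q : ℕ → V} {N Nq k : ℕ} {r D : ℝ}

/-- Cutting a petal around the end of the current geodesic. -/
lemma split_along (S : PetalState G w₀ w Y x₀ p N) (IH : PetalIH G w₀ Y)
    (hWY : W ⊆ Y) (hZY : Z ⊆ Y) (hdisj : Disjoint W Z) (hun : ∀ z ∈ Y, z ∈ W ∨ z ∈ Z)
    (hD : D = pre w p N) (hrD : 2 * r ≤ D) (hkN : k < N)
    (hk : r < D - pre w p k) (hk' : D - pre w p (k + 1) ≤ r)
    (hpZ : ∀ i ≤ k, p i ∈ Z) (hpW : ∀ i ≤ N, k + 1 ≤ i → p i ∈ W)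
    (hZr : ∀ z ∈ Z, Rc (rs G Z) w x₀ z (wdist (rs G Y) w x₀ z))
    (hWr : ∀ z ∈ W, ∃ i ≤ N, D - pre w p i ≤ r ∧ ∃ ℓ, Rc (rs G W) w (p i) z ℓ ∧
          2 * ℓ ≤ r - D - pre w p i + 2 * wdist (rs G Y) w x₀ z) :
    SplitTrees G w₀ w Y x₀ p N W Z (p k) (p (k + 1)) := by
  have hcW : #W < #Y := card_lt_card ⟨hWY, fun h =>
    disjoint_left.mp hdisj (h (hZY (hpZ k le_rfl))) (hpZ k le_rfl)⟩
  have hcZ : #Z < #Y := card_lt_card ⟨hZY, fun h =>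
    disjoint_left.mp hdisj (hpW (k + 1) hkN le_rfl) (h (hWY (hpW (k + 1) hkN le_rfl)))⟩
  have hw := S.nonneg
  have hmono : ∀ i j, i ≤ j → j ≤ N → pre w p i ≤ pre w p j := fun i j hij hj =>
    pre_mono hw p hij fun l _ hl => S.adj l (by omega)
  have hadjZ : ∀ i < k, (rs G Z).Adj (p i) (p (i + 1)) := fun i hi =>
    ⟨(S.adj i (by omega)).1, hpZ i (by omega), hpZ (i + 1) (by omega)⟩
  have hadjW : ∀ i < N, k + 1 ≤ i → (rs G W).Adj (p i) (p (i + 1)) := fun i hi hik =>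
    ⟨(S.adj i hi).1, hpW i hi.le hik, hpW (i + 1) hi (by omega)⟩
  have hZs : ∀ a b, (rs G Z).Adj a b → (rs G Y).Adj a b := fun a b h => rs_mono hZY h
  have hWs : ∀ a b, (rs G W).Adj a b → (rs G Y).Adj a b := fun a b h => rs_mono hWY h
  have S₁ : PetalState G w₀ w Z x₀ p k :=
    { mem := S.start ▸ hpZ 0 (by omega)
      conn := fun z hz => (hZr z hz).reachable
      wpos := fun a b h => S.wpos a b (hZs a b h)
      wle := fun a b h => S.wle a b (hZs a b h)
      lew := fun a b h => S.lew a b (hZs a b h)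
      start := S.start
      adj := hadjZ
      short := by
        rw [← S.start]
        refine short_of_le (rs_mono hZY) hw hadjZ fun i hi => ?_
        rw [S.start, S.short i (by omega)]
      full := by
        intro a b hab hne
        refine S.full a b (hZs a b hab) fun i hi h => ?_
        by_cases hik : i < k
        · exact hne i hik h
        · have hm : p (i + 1) ∈ s(a, b) := by rw [h]; exact Sym2.mem_mk_right _ _
          have hW := hpW (i + 1) hi (by omega)
          rcases Sym2.mem_iff.mp hm with h | h
          · exact disjoint_left.mp hdisj hW (h ▸ hab.2.1)
          · exact disjoint_left.mp hdisj hW (h ▸ hab.2.2) }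
  have hWd : ∀ z ∈ W, ∃ ℓ, Rc (rs G W) w (p (k + 1)) z ℓ ∧
      ℓ ≤ wdist (rs G Y) w x₀ z - pre w p (k + 1) + r / 2 := by
    intro z hz
    obtain ⟨i, hi, hir, ℓ, hℓ, hℓ'⟩ := hWr z hz
    have hik : k + 1 ≤ i := by
      by_contra hc
      have := hmono i k (by omega) hkN.le
      linarith
    refine ⟨_, (pre_rc p hik fun l h1 h2 => hadjW l (by omega) h1).trans hℓ, ?_⟩
    have := hmono i N hi le_rfl
    linarith
  have S₂ : PetalState G w₀ w W (p (k + 1)) (fun i => p (k + 1 + i)) (N - (k + 1)) :=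
    { mem := hpW (k + 1) hkN le_rfl
      conn := fun z hz => by
        obtain ⟨ℓ, h, -⟩ := hWd z hz
        exact h.reachable
      wpos := fun a b h => S.wpos a b (hWs a b h)
      wle := fun a b h => S.wle a b (hWs a b h)
      lew := fun a b h => S.lew a b (hWs a b h)
      start := rfl
      adj := fun i hi => hadjW (k + 1 + i) (by omega) (by omega)
      short := by
        refine short_of_le (rs_mono hWY) hw (p := fun i => p (k + 1 + i))
          (fun i hi => hadjW (k + 1 + i) (by omega) (by omega)) fun i hi => ?_
        rw [pre_shift]
        have h1 := S.short (k + 1) hkN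
        have h2 := S.short (k + 1 + i) (by omega)
        have hm : ∀ z ∈ Y, (rs G Y).Reachable (p (k + 1)) z := fun z hz =>
          (S.conn _ (hWY (hpW (k + 1) hkN le_rfl))).symm.trans (S.conn z hz)
        have h3 := wdist_triangle hw (S.conn _ (hWY (hpW (k + 1) hkN le_rfl)))
          (hm _ (hWY (hpW (k + 1 + i) (by omega) (by omega))))
        simp only [add_zero]
        linarith
      full := by
        intro a b hab hne
        refine S.full a b (hWs a b hab) fun i hi h => ?_
        by_cases hik : k + 1 ≤ i
        · refine hne (i - (k + 1)) (by omega) ?_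
          rw [h, show k + 1 + (i - (k + 1)) = i by omega,
            show k + 1 + (i - (k + 1) + 1) = i + 1 by omega]
        · have hm : p i ∈ s(a, b) := by rw [h]; exact Sym2.mem_mk_left _ _
          have hZ := hpZ i (by omega)
          rcases Sym2.mem_iff.mp hm with h | h
          · exact disjoint_right.mp hdisj hZ (h ▸ hab.2.1)
          · exact disjoint_right.mp hdisj hZ (h ▸ hab.2.2) }
  obtain ⟨T₁, M₁, hT₁, hC₁⟩ := IH Z hcZ _ _ _ _ S₁
  obtain ⟨T₂, M₂, hT₂, hC₂⟩ := IH W hcW _ _ _ _ S₂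
  refine ⟨T₁, T₂, M₁, M₂, hT₁.le, hT₂.le, hT₁.card, hT₂.card, hC₁, hC₂,
    fun z hz => (hT₁.rad z hz).reachable, fun z hz => (hT₂.rad z hz).reachable, ?_⟩
  intro T h1 h2 hyx
  have hedge : Rc T w₀ (p k) (p (k + 1)) (2 * (pre w p (k + 1) - pre w p k)) := by
    refine (Rc.adj hyx).le ((S.lew _ _ (S.adj k hkN)).trans (le_of_eq ?_))
    rw [pre_succ]; ring
  have hto : Rc T w₀ x₀ (p (k + 1)) (2 * pre w p (k + 1)) :=
    ((hT₁.path.mono h1).trans hedge).le (by linarith)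
  refine ⟨fun z hz => ?_, ?_⟩
  · rcases hun z hz with hz | hz
    · obtain ⟨ℓ, hℓ, hℓ'⟩ := hWd z hz
      have := wdist_le (hw.mono (rs_mono hWY)) hℓ
      exact (hto.trans ((hT₂.rad z hz).mono h2)).le (by linarith)
    · have := wdist_le (hw.mono (rs_mono hZY)) (hZr z hz)
      exact ((hT₁.rad z hz).mono h1).le (by linarith)
  · have h3 := hT₂.path
    rw [pre_shift, show k + 1 + (N - (k + 1)) = N by omega] at h3
    exact (hto.trans (h3.mono h2)).le (by linarith)

/-- Cutting a petal around the end of a new geodesic `q`, away from the current one. -/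
lemma split_away (S : PetalState G w₀ w Y x₀ p N) (IH : PetalIH G w₀ Y)
    (hWY : W ⊆ Y) (hZY : Z ⊆ Y) (hdisj : Disjoint W Z) (hun : ∀ z ∈ Y, z ∈ W ∨ z ∈ Z)
    (hqadj : ∀ i < Nq, (rs G Y).Adj (q i) (q (i + 1)))
    (hqshort : ∀ i ≤ Nq, wdist (rs G Y) w x₀ (q i) = pre w q i)
    (hkN : k < Nq)
    (hk : r < D - pre w q k)
    (hpZ : ∀ i ≤ N, p i ∈ Z) (hqZ : ∀ i ≤ k, q i ∈ Z) (hqW : ∀ i ≤ Nq, k + 1 ≤ i → q i ∈ W)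
    (hZr : ∀ z ∈ Z, Rc (rs G Z) w x₀ z (wdist (rs G Y) w x₀ z))
    (hWr : ∀ z ∈ W, ∃ i ≤ Nq, D - pre w q i ≤ r ∧ ∃ ℓ, Rc (rs G W) w (q i) z ℓ ∧
          2 * ℓ ≤ r - D - pre w q i + 2 * wdist (rs G Y) w x₀ z) :
    SplitTrees G w₀ w Y x₀ p N W Z (q k) (q (k + 1)) := by
  have hcW : #W < #Y := card_lt_card ⟨hWY, fun h =>
    disjoint_left.mp hdisj (h (hZY (hqZ k le_rfl))) (hqZ k le_rfl)⟩
  have hcZ : #Z < #Y := card_lt_card ⟨hZY, fun h =>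
    disjoint_left.mp hdisj (hqW (k + 1) hkN le_rfl) (h (hWY (hqW (k + 1) hkN le_rfl)))⟩
  have hw := S.nonneg
  have hmono : ∀ i j, i ≤ j → j ≤ Nq → pre w q i ≤ pre w q j := fun i j hij hj =>
    pre_mono hw q hij fun l _ hl => hqadj l (by omega)
  have hadjZ : ∀ i < N, (rs G Z).Adj (p i) (p (i + 1)) := fun i hi =>
    ⟨(S.adj i hi).1, hpZ i hi.le, hpZ (i + 1) hi⟩
  have hadjW : ∀ i < Nq, k + 1 ≤ i → (rs G W).Adj (q i) (q (i + 1)) := fun i hi hik =>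
    ⟨(hqadj i hi).1, hqW i hi.le hik, hqW (i + 1) hi (by omega)⟩
  have hZs : ∀ a b, (rs G Z).Adj a b → (rs G Y).Adj a b := fun a b h => rs_mono hZY h
  have hWs : ∀ a b, (rs G W).Adj a b → (rs G Y).Adj a b := fun a b h => rs_mono hWY h
  have S₁ : PetalState G w₀ w Z x₀ p N :=
    { mem := S.start ▸ hpZ 0 (by omega)
      conn := fun z hz => (hZr z hz).reachable
      wpos := fun a b h => S.wpos a b (hZs a b h)
      wle := fun a b h => S.wle a b (hZs a b h)
      lew := fun a b h => S.lew a b (hZs a b h)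
      start := S.start
      adj := hadjZ
      short := by
        rw [← S.start]
        refine short_of_le (rs_mono hZY) hw hadjZ fun i hi => ?_
        rw [S.start, S.short i (by omega)]
      full := fun a b hab hne => S.full a b (hZs a b hab) hne }
  have hWfull : ∀ a b, (rs G W).Adj a b → w s(a, b) = w₀ s(a, b) := by
    intro a b hab
    refine S.full a b (hWs a b hab) fun i hi h => ?_
    have hm : p i ∈ s(a, b) := by rw [h]; exact Sym2.mem_mk_left _ _
    rcases Sym2.mem_iff.mp hm with h | h
    · exact disjoint_right.mp hdisj (hpZ i hi.le) (h ▸ hab.2.1)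
    · exact disjoint_right.mp hdisj (hpZ i hi.le) (h ▸ hab.2.2)
  set w' : Sym2 V → ℝ := fun e =>
    if ∃ i < Nq - (k + 1), e = s(q (k + 1 + i), q (k + 1 + (i + 1))) then w e / 2 else w e with hw'
  have hwW : ∀ a b, (rs G W).Adj a b → 0 < w s(a, b) := fun a b h => S.wpos a b (hWs a b h)
  have hw'le : ∀ a b, (rs G W).Adj a b → w' s(a, b) ≤ w s(a, b) := by
    intro a b hab
    have := hwW a b hab
    simp only [hw']
    split_ifs <;> linarith
  have hlew' : ∀ a b, (rs G W).Adj a b → w s(a, b) ≤ 2 * w' s(a, b) := by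
    intro a b hab
    have := hwW a b hab
    simp only [hw']
    split_ifs <;> linarith
  have hw'n : NonnegOn (rs G W) w' := fun a b hab => by
    have := hlew' a b hab
    have := hwW a b hab
    linarith
  have hpre' : ∀ i ≤ Nq - (k + 1), pre w' (fun i => q (k + 1 + i)) i =
      (pre w q (k + 1 + i) - pre w q (k + 1)) / 2 := by
    intro i hi
    rw [← pre_shift, pre, pre, sum_div]
    refine sum_congr rfl fun l hl => ?_
    simp only [hw']
    rw [if_pos ⟨l, by rw [mem_range] at hl; omega, rfl⟩]
  have hWd : ∀ z ∈ W, ∃ ℓ, Rc (rs G W) w' (q (k + 1)) z ℓ ∧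
      2 * ℓ ≤ 2 * wdist (rs G Y) w x₀ z - pre w q k - pre w q (k + 1) := by
    intro z hz
    obtain ⟨i, hi, hir, ℓ, hℓ, hℓ'⟩ := hWr z hz
    have hik : k + 1 ≤ i := by
      by_contra hc
      have := hmono i k (by omega) hkN.le
      linarith
    have h1 : Rc (rs G W) w' (q (k + 1 + 0)) (q (k + 1 + (i - (k + 1)))) _ :=
      pre_rc (fun i => q (k + 1 + i)) (Nat.zero_le (i - (k + 1)))
      fun l _ h2 => hadjW (k + 1 + l) (by omega) (by omega)
    rw [hpre' _ (by omega), pre_zero, show k + 1 + (i - (k + 1)) = i by omega, add_zero] at h1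
    refine ⟨_, h1.trans (hℓ.map le_rfl hw'le), ?_⟩
    linarith
  have S₂ : PetalState G w₀ w' W (q (k + 1)) (fun i => q (k + 1 + i)) (Nq - (k + 1)) :=
    { mem := hqW (k + 1) hkN le_rfl
      conn := fun z hz => by
        obtain ⟨ℓ, h, -⟩ := hWd z hz
        exact h.reachable
      wpos := fun a b h => by linarith [hwW a b h, hlew' a b h]
      wle := fun a b h => (hw'le a b h).trans (S.wle a b (hWs a b h))
      lew := fun a b h => by rw [← hWfull a b h]; exact hlew' a b h
      start := rfl
      adj := fun i hi => hadjW (k + 1 + i) (by omega) (by omega)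
      short := by
        refine short_of_le le_rfl hw'n (p := fun i => q (k + 1 + i))
          (fun i hi => hadjW (k + 1 + i) (by omega) (by omega)) fun i hi => ?_
        rw [hpre' i hi]
        have h1 := hqshort (k + 1) hkN
        have h2 := hqshort (k + 1 + i) (by omega)
        have hm : ∀ z ∈ W, (rs G W).Reachable (q (k + 1)) z := fun z hz => by
          obtain ⟨ℓ, h, -⟩ := hWd z hz
          exact h.reachable
        have h4 := (rc_wdist hw'n (hm _ (hqW (k + 1 + i) (by omega) (by omega)))).map_mul
          (B := rs G Y) (w' := w) (K := 2) (by norm_num)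
          (fun a b hab => (Rc.adj (hWs a b hab)).le (hlew' a b hab))
        have h3 := wdist_le hw ((rc_wdist hw (S.conn _ (hWY (hqW (k + 1) hkN le_rfl)))).trans h4)
        simp only [add_zero]
        linarith
      full := by
        intro a b hab hne
        rw [← hWfull a b hab]
        simp only [hw']
        rw [if_neg]
        rintro ⟨i, hi, h⟩
        exact hne i hi h }
  obtain ⟨T₁, M₁, hT₁, hC₁⟩ := IH Z hcZ _ _ _ _ S₁
  obtain ⟨T₂, M₂, hT₂, hC₂⟩ := IH W hcW _ _ _ _ S₂
  refine ⟨T₁, T₂, M₁, M₂, hT₁.le, hT₂.le, hT₁.card, hT₂.card, hC₁, hC₂,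
    fun z hz => (hT₁.rad z hz).reachable, fun z hz => (hT₂.rad z hz).reachable, ?_⟩
  intro T h1 h2 hyx
  have hradZ : ∀ z ∈ Z, Rc T w₀ x₀ z (4 * wdist (rs G Y) w x₀ z) := fun z hz => by
    have := wdist_le (hw.mono (rs_mono hZY)) (hZr z hz)
    exact ((hT₁.rad z hz).mono h1).le (by linarith)
  have hedge : Rc T w₀ (q k) (q (k + 1)) (2 * (pre w q (k + 1) - pre w q k)) := by
    refine (Rc.adj hyx).le ((S.lew _ _ (hqadj k hkN)).trans (le_of_eq ?_))
    rw [pre_succ]; ring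
  refine ⟨fun z hz => ?_, hT₁.path.mono h1⟩
  rcases hun z hz with hz | hz
  · obtain ⟨ℓ, hℓ, hℓ'⟩ := hWd z hz
    have := wdist_le hw'n hℓ
    have h3 := hradZ (q k) (hqZ k le_rfl)
    rw [hqshort k hkN.le] at h3
    exact ((h3.trans hedge).trans ((hT₂.rad z hz).mono h2)).le (by linarith)
  · exact hradZ z hz

end Split

/-- The petal recursion. -/
lemma exists_petalTree (hw₀ : ∀ a b, G.Adj a b → 0 < w₀ s(a, b)) (n : ℕ) :
    ∀ Y : Finset V, #Y = n → ∀ w x₀ p N, PetalState G w₀ w Y x₀ p N →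
      ∃ T M, PetalTree G w₀ w Y x₀ p N T ∧ CostBound G w₀ Y T M := by
  induction n using Nat.strong_induction_on with
  | _ n ih =>
    intro Y hn w x₀ p N S
    have IH : PetalIH G w₀ Y := fun Y' hY' => ih (#Y') (hn ▸ hY') Y' rfl
    have hw := S.nonneg
    by_cases htriv : ∀ z ∈ Y, z = x₀
    · have hY : Y = {x₀} := by
        ext z
        rw [mem_singleton]
        exact ⟨htriv z, fun h => h ▸ S.mem⟩
      have hN : N = 0 := by
        by_contra hN
        have h := S.adj 0 (by omega)
        exact h.1.ne ((htriv _ h.2.1).trans (htriv _ h.2.2).symm)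
      subst hN
      have hsurv : surv G w₀ Y = ∅ := by
        rw [eq_empty_iff_forall_notMem]
        rintro ⟨u, v⟩ h
        have := (mem_surv.mp h).1
        exact this.2.2 ((htriv u this.1).trans (htriv v this.2.1).symm)
      refine ⟨⊥, ∅, ⟨bot_le, by simp [hY], ?_, ?_⟩, ⟨empty_subset _, ?_, ?_⟩⟩
      · intro z hz
        rw [htriv z hz]
        exact Rc.refl (mul_nonneg (by norm_num) (wdist_nonneg hw))
      · rw [S.start, pre_zero]
        exact Rc.refl (by norm_num)
      · rw [hsurv]; simp; positivity
      · intro u _ x hx; simp; positivity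
    · push Not at htriv
      obtain ⟨z₁, hz₁, hz₁x⟩ := htriv
      obtain ⟨v, hv, hvmax⟩ := exists_max_image Y (wdist (rs G Y) w x₀) ⟨x₀, S.mem⟩
      set Δ := wdist (rs G Y) w x₀ v with hΔ
      have hΔpos : 0 < Δ :=
        lt_of_lt_of_le (wdist_pos S.wpos (S.conn z₁ hz₁) (Ne.symm hz₁x)) (hvmax z₁ hz₁)
      have hq : ∃ (q : ℕ → V) (Nq : ℕ), q 0 = x₀ ∧ (∀ i < Nq, (rs G Y).Adj (q i) (q (i + 1))) ∧
          (∀ i ≤ Nq, wdist (rs G Y) w x₀ (q i) = pre w q i) ∧ Δ / 2 ≤ pre w q Nq ∧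
          ((q = p ∧ Nq = N) ∨ (pre w p N < Δ / 2 ∧ Δ ≤ pre w q Nq)) := by
        by_cases hcase : Δ / 2 ≤ pre w p N
        · exact ⟨p, N, S.start, S.adj, S.short, hcase, .inl ⟨rfl, rfl⟩⟩
        · obtain ⟨q, Nq, hq0, hqN, hqadj, hqs⟩ := (rc_wdist hw (S.conn v hv)).exists_seq
          change pre w q Nq ≤ Δ at hqs
          have hge : ∀ i ≤ Nq, pre w q i ≤ wdist (rs G Y) w x₀ (q i) := by
            intro i hi
            have h1 : Rc (rs G Y) w (q 0) (q i) (pre w q i - pre w q 0) :=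
              pre_rc q (Nat.zero_le i) fun l _ hl => hqadj l (by omega)
            have h2 : Rc (rs G Y) w (q i) (q Nq) (pre w q Nq - pre w q i) :=
              pre_rc q hi fun l _ hl => hqadj l (by omega)
            rw [hq0] at h1
            rw [hqN] at h2
            have h3 := wdist_le hw ((rc_wdist hw h1.reachable).trans h2)
            linarith
          have hshort := short_of_le (le_refl (rs G Y)) hw hqadj (by rwa [hq0])
          rw [hq0] at hshort
          have hD : Δ ≤ pre w q Nq := by
            rw [← hshort Nq le_rfl, hqN]
          exact ⟨q, Nq, hq0, hqadj, hshort, by linarith, .inr ⟨not_le.mp hcase, hD⟩⟩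
      obtain ⟨q, Nq, hq0, hqadj, hqshort, hDΔ, hcase⟩ := hq
      obtain ⟨pos, hP1, hP2, hP3, hP4, hP5⟩ := exists_petal hw S.mem S.conn hq0 hqadj hqshort
      set D := pre w q Nq with hD
      have hqY : ∀ i ≤ Nq, q i ∈ Y := by
        intro i hi
        cases i with
        | zero => rw [hq0]; exact S.mem
        | succ i => exact (hqadj i (by omega)).2.2
      have hpY : ∀ i ≤ N, p i ∈ Y := by
        intro i hi
        cases i with
        | zero => rw [S.start]; exact S.mem
        | succ i => exact (S.adj i (by omega)).2.2
      obtain ⟨r, s, hr0, hrΔ, hs0, hne, hα, hβ⟩ := exists_cut Y pos (show 0 < Δ / 4 by positivity)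
        ⟨q Nq, hqY Nq le_rfl, by rw [hP2 Nq le_rfl]; linarith⟩
        ⟨q 0, hqY 0 (by omega), by rw [hP2 0 (by omega), pre_zero]; linarith⟩
      have hmono : ∀ i j, i ≤ j → j ≤ Nq → pre w q i ≤ pre w q j := fun i j hij hj =>
        pre_mono hw q hij fun l _ hl => hqadj l (by omega)
      have hex : ∃ j, D - pre w q j ≤ r := ⟨Nq, by linarith⟩
      obtain ⟨k, hkN, hk, hk'⟩ : ∃ k < Nq, r < D - pre w q k ∧ D - pre w q (k + 1) ≤ r := by
        have h1 := Nat.find_spec hex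
        have h2 : Nat.find hex ≤ Nq := Nat.find_min' hex (by linarith)
        have h3 : Nat.find hex ≠ 0 := by
          intro h
          rw [h, pre_zero] at h1
          linarith
        obtain ⟨k, hk⟩ := Nat.exists_eq_succ_of_ne_zero h3
        exact ⟨k, by omega, not_le.mp (Nat.find_min hex (by omega)), by rw [hk] at h1; exact h1⟩
      set W : Finset V := {u ∈ Y | pos u ≤ r} with hW
      set Z : Finset V := {u ∈ Y | ¬ pos u ≤ r} with hZ
      have hWY : W ⊆ Y := filter_subset _ _
      have hZY : Z ⊆ Y := filter_subset _ _
      have hdisj : Disjoint W Z := disjoint_filter_filter_not _ _ _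
      have hun : ∀ z ∈ Y, z ∈ W ∨ z ∈ Z := fun z hz => by
        by_cases h : pos z ≤ r
        · exact .inl (mem_filter.mpr ⟨hz, h⟩)
        · exact .inr (mem_filter.mpr ⟨hz, h⟩)
      have hqZ : ∀ i ≤ k, q i ∈ Z := fun i hi => by
        refine mem_filter.mpr ⟨hqY i (by omega), ?_⟩
        rw [hP2 i (by omega)]
        linarith [hmono i k hi hkN.le]
      have hqW : ∀ i ≤ Nq, k + 1 ≤ i → q i ∈ W := fun i hi hki => by
        refine mem_filter.mpr ⟨hqY i hi, ?_⟩
        rw [hP2 i hi]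
        linarith [hmono (k + 1) i hki hi]
      have hZr : ∀ z ∈ Z, Rc (rs G Z) w x₀ z (wdist (rs G Y) w x₀ z) := fun z hz =>
        hP4 r z (mem_filter.mp hz).1 (mem_filter.mp hz).2
      have hWr : ∀ z ∈ W, ∃ i ≤ Nq, D - pre w q i ≤ r ∧ ∃ ℓ, Rc (rs G W) w (q i) z ℓ ∧
          2 * ℓ ≤ r - D - pre w q i + 2 * wdist (rs G Y) w x₀ z := fun z hz =>
        hP5 r z (mem_filter.mp hz).1 (mem_filter.mp hz).2
      have hsplit : SplitTrees G w₀ w Y x₀ p N W Z (q k) (q (k + 1)) := by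
        rcases hcase with ⟨rfl, rfl⟩ | ⟨hpN, hΔD⟩
        · exact split_along S IH hWY hZY hdisj hun hD (by linarith) hkN hk hk' hqZ hqW hZr hWr
        · refine split_away S IH hWY hZY hdisj hun hqadj hqshort hkN hk ?_ hqZ hqW hZr hWr
          intro i hi
          refine mem_filter.mpr ⟨hpY i hi, ?_⟩
          have h1 := hP1 (p i) (hpY i hi)
          rw [S.short i hi] at h1
          have h2 : pre w p i ≤ pre w p N := pre_mono hw p hi fun l _ hl => S.adj l (by omega)
          linarith
      obtain ⟨T₁, T₂, M₁, M₂, hT₁, hT₂, hc₁, hc₂, hC₁, hC₂, hr₁, hr₂, hglue⟩ := hsplit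
      obtain ⟨T, hT, h1, h2, hadj, hcard⟩ := exists_join hT₁ hT₂ hc₁ hc₂ (hqadj k hkN)
      obtain ⟨hrad, hpath⟩ := hglue T h1 h2 hadj
      have hw₀n : NonnegOn G w₀ := fun a b h => (hw₀ a b h).le
      have hTn : NonnegOn T w₀ := hw₀n.mono (hT.trans rs_le)
      obtain ⟨M, hM⟩ := CostBound.combine (T := T) (Δ := Δ) hw₀ (hT.trans rs_le) h1 h2 hΔpos
        (fun u hu v hv => by
          have := wdist_le hTn ((hrad u hu).symm.trans (hrad v hv))
          have := hvmax u hu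
          have := hvmax v hv
          linarith)
        (fun u hu v hv ℓ hℓ => by
          have h3 := hP3 u hu v hv
          have h4 := wdist_le hw (hℓ.map le_rfl S.wle)
          linarith)
        hne hα hβ hC₁ hC₂
        (fun u hu hur v hv hvr => (hr₁ u (mem_filter.mpr ⟨hu, hur⟩)).symm.trans
          (hr₁ v (mem_filter.mpr ⟨hv, hvr⟩)))
        (fun u hu hur v hv hvr => (hr₂ u (mem_filter.mpr ⟨hu, hur⟩)).symm.trans
          (hr₂ v (mem_filter.mpr ⟨hv, hvr⟩)))
      exact ⟨T, M, ⟨hT, hcard, hrad, hpath⟩, hM⟩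

end Induction

section LayerCake

lemma rpow_three_halves_four_pow (j : ℕ) : ((4 : ℝ) ^ j) ^ (3 / 2 : ℝ) = 8 ^ j := by
  have h4 : (4 : ℝ) ^ (3 / 2 : ℝ) = 8 := by
    calc (4 : ℝ) ^ (3 / 2 : ℝ) = ((2 : ℝ) ^ (2 : ℝ)) ^ (3 / 2 : ℝ) := by norm_num
      _ = 2 ^ (3 : ℝ) := by rw [← Real.rpow_mul (by norm_num)]; norm_num
      _ = 8 := by norm_num
  rw [← Real.rpow_natCast, ← Real.rpow_mul (by norm_num), mul_comm, Real.rpow_mul (by norm_num), h4,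
    Real.rpow_natCast]

lemma sum_rpow_le_of_weak {α : Type*} (S : Finset α) (χ : α → ℝ) (hχ : ∀ a ∈ S, 1 ≤ χ a) {B : ℝ}
    (hB : 0 ≤ B) (h : ∀ l : ℝ, 1 ≤ l → (#{a ∈ S | l ≤ χ a} : ℝ) ≤ B / l ^ 2) :
    ∑ a ∈ S, χ a ^ (3 / 2 : ℝ) ≤ 16 * B := by
  obtain ⟨J, hJ⟩ : ∃ J : ℕ, ∀ a ∈ S, χ a < 4 ^ J := by
    obtain ⟨J, hJ⟩ := pow_unbounded_of_one_lt (∑ a ∈ S, χ a) (show (1 : ℝ) < 4 by norm_num)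
    exact ⟨J, fun a ha => lt_of_le_of_lt
      (single_le_sum (f := χ) (fun b hb => zero_le_one.trans (hχ b hb)) ha) hJ⟩
  have hpt : ∀ a ∈ S, χ a ^ (3 / 2 : ℝ) ≤
      ∑ j ∈ range J, if (4 : ℝ) ^ j ≤ χ a then (8 : ℝ) ^ (j + 1) else 0 := by
    intro a ha
    have hex : ∃ j : ℕ, χ a < 4 ^ j := ⟨J, hJ a ha⟩
    have h0 : Nat.find hex ≠ 0 := by
      intro h0
      have := Nat.find_spec hex
      rw [h0, pow_zero] at this
      linarith [hχ a ha]
    obtain ⟨i, hi⟩ := Nat.exists_eq_succ_of_ne_zero h0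
    have h1 : χ a < 4 ^ (i + 1) := by have := Nat.find_spec hex; rwa [hi] at this
    have h2 : (4 : ℝ) ^ i ≤ χ a := not_lt.mp (Nat.find_min hex (by omega))
    have h3 : i < J := by
      have := Nat.find_min' hex (hJ a ha)
      omega
    calc χ a ^ (3 / 2 : ℝ) ≤ ((4 : ℝ) ^ (i + 1)) ^ (3 / 2 : ℝ) :=
          Real.rpow_le_rpow (zero_le_one.trans (hχ a ha)) h1.le (by norm_num)
      _ = if (4 : ℝ) ^ i ≤ χ a then (8 : ℝ) ^ (i + 1) else 0 := by
          rw [if_pos h2, rpow_three_halves_four_pow]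
      _ ≤ _ := single_le_sum (f := fun j => if (4 : ℝ) ^ j ≤ χ a then (8 : ℝ) ^ (j + 1) else 0)
          (fun j _ => by positivity) (mem_range.mpr h3)
  refine (sum_le_sum hpt).trans ?_
  rw [sum_comm]
  have hj : ∀ j ∈ range J, ∑ a ∈ S, (if (4 : ℝ) ^ j ≤ χ a then (8 : ℝ) ^ (j + 1) else 0) ≤
      8 * B * (1 / 2) ^ j := by
    intro j _
    rw [← sum_filter, sum_const, nsmul_eq_mul]
    have h1 := h (4 ^ j) (one_le_pow₀ (by norm_num))
    refine (mul_le_mul_of_nonneg_right h1 (by positivity)).trans (le_of_eq ?_)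
    have h4 : (4 : ℝ) ^ j = 2 ^ j * 2 ^ j := by rw [← mul_pow]; norm_num
    have h8 : (8 : ℝ) ^ j = 2 ^ j * 2 ^ j * 2 ^ j := by rw [← mul_pow, ← mul_pow]; norm_num
    rw [pow_succ (8 : ℝ), h8, h4, one_div, inv_pow]
    field_simp
  refine (sum_le_sum hj).trans ?_
  rw [← mul_sum]
  have hg : ∑ j ∈ range J, (1 / 2 : ℝ) ^ j ≤ 2 := by
    rw [geom_sum_eq (by norm_num)]
    have : (0 : ℝ) ≤ (1 / 2) ^ J := by positivity
    rw [div_le_iff_of_neg (by norm_num)]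
    linarith
  nlinarith

end LayerCake

section Tree

/-- Every weighted graph has a spanning tree whose distortion has bounded `3/2`-moment. -/
lemma exists_tree_moment : ∃ C : ℝ, 0 < C ∧ ∀ (V : Type) [Fintype V] (G : SimpleGraph V)
    (w : Sym2 V → ℝ), G.Connected → (∀ a b, G.Adj a b → 0 < w s(a, b)) →
    ∃ T : SimpleGraph V, T ≤ G ∧ T.IsTree ∧
      ∑ e ∈ (univ : Finset V).offDiag, (wdist T w e.1 e.2 / wdist G w e.1 e.2) ^ (3 / 2 : ℝ) ≤
        C * (Fintype.card V : ℝ) ^ 2 := by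
  refine ⟨2 ^ 14 * (516 * 36) ^ 2 + 16 * (576 * 256 ^ 2), by norm_num, ?_⟩
  intro V _ G w hG hw
  obtain ⟨x₀⟩ := hG.nonempty
  have hwn : NonnegOn G w := fun a b h => (hw a b h).le
  have hrs : rs G univ = G := by
    ext a b
    simp [rs]
  have S : PetalState G w w univ x₀ (fun _ => x₀) 0 :=
    { mem := mem_univ _
      conn := fun z _ => by rw [hrs]; exact hG.preconnected x₀ z
      wpos := fun a b h => hw a b h.1
      wle := fun _ _ _ => le_rfl
      lew := fun a b h => by linarith [hw a b h.1]
      start := rfl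
      adj := fun i hi => by omega
      short := fun i hi => by
        obtain rfl : i = 0 := by omega
        rw [hrs, wdist_self hwn, pre_zero]
      full := fun _ _ _ _ => rfl }
  obtain ⟨T, M, hT, hM⟩ := exists_petalTree hw _ univ rfl _ _ _ _ S
  have hTG : T ≤ G := hT.le.trans rs_le
  have hTn : NonnegOn T w := hwn.mono hTG
  have hconn : T.Connected := by
    have : ∀ z, T.Reachable x₀ z := fun z => (hT.rad z (mem_univ _)).reachable
    exact (SimpleGraph.connected_iff _).mpr ⟨fun a b => (this a).symm.trans (this b), ⟨x₀⟩⟩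
  have htree : T.IsTree := by
    rw [SimpleGraph.isTree_iff_connected_and_card]
    refine ⟨hconn, ?_⟩
    have h1 := hconn.card_vert_le_card_edgeSet_add_one
    have h2 := hT.card
    rw [card_univ, ← Nat.card_eq_fintype_card, ← Nat.card_coe_set_eq] at h2
    omega
  refine ⟨T, hTG, htree, ?_⟩
  have hsurv : surv G w univ = (univ : Finset V).offDiag := by
    refine filter_true_of_mem fun e _ => ?_
    rw [hrs]
    exact rc_wdist hwn (hG.preconnected _ _)
  have hsub := hM.sub
  have hsum := hM.sum_le
  have hcnt := hM.count_le
  rw [hsurv] at hsub hsum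
  rw [card_univ] at hsum
  simp only [card_univ, mem_univ, forall_true_left] at hcnt
  set n : ℝ := (Fintype.card V : ℝ) with hn
  rw [← sum_sdiff hsub]
  have hMsum : ∑ e ∈ M, (wdist T w e.1 e.2 / wdist G w e.1 e.2) ^ (3 / 2 : ℝ) ≤
      16 * (576 * 256 ^ 2) * n ^ 2 := by
    have hfib : ∑ e ∈ M, (wdist T w e.1 e.2 / wdist G w e.1 e.2) ^ (3 / 2 : ℝ) =
        ∑ u : V, ∑ v : V with (u, v) ∈ M, (wdist T w u v / wdist G w u v) ^ (3 / 2 : ℝ) := by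
      rw [sum_sigma']
      refine sum_bij' (fun e _ => ⟨e.1, e.2⟩) (fun e _ => (e.1, e.2)) ?_ ?_ ?_ ?_ ?_ <;> simp
    rw [hfib]
    have hu : ∀ u ∈ (univ : Finset V), ∑ v : V with (u, v) ∈ M,
        (wdist T w u v / wdist G w u v) ^ (3 / 2 : ℝ) ≤ 16 * (576 * 256 ^ 2 * n) := by
      intro u _
      have hd : ∀ v, (u, v) ∈ M → 0 < wdist G w u v := fun v hv =>
        wdist_pos hw (hG.preconnected _ _) (by simpa using hsub hv)
      refine sum_rpow_le_of_weak _ (fun v => wdist T w u v / wdist G w u v) ?_ (by positivity) ?_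
      · intro v hv
        rw [one_le_div (hd v (mem_filter.mp hv).2)]
        exact wdist_le hwn ((rc_wdist hTn (hconn.preconnected _ _)).mono hTG)
      · intro l hl
        have h1 := hcnt u (1 / l) (by positivity)
        refine le_trans ?_ (h1.trans (le_of_eq (by field_simp)))
        norm_cast
        refine card_le_card fun v hv => ?_
        simp only [mem_filter, mem_univ, true_and] at hv ⊢
        refine ⟨hv.1, ?_⟩
        have h2 := hv.2
        rw [le_div_iff₀ (hd v hv.1)] at h2
        rw [one_div, inv_mul_eq_div, le_div_iff₀ (by positivity)]
        linarith
    refine (sum_le_sum hu).trans (le_of_eq ?_)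
    rw [sum_const, card_univ, nsmul_eq_mul, ← hn]
    ring
  nlinarith

end Tree

section Metric

variable {V : Type*}

/-- Pseudo-metrics with real values, as a property of a function. -/
structure IsDist (d : V → V → ℝ) : Prop where
  nonneg : ∀ x y, 0 ≤ d x y
  self : ∀ x, d x x = 0
  comm : ∀ x y, d x y = d y x
  tri : ∀ x y z, d x z ≤ d x y + d y z

variable {d : V → V → ℝ}

/-- A sparse family of stars which connects every pair of points at distance at most `L`. -/
lemma exists_stars (hd : IsDist d) {K t : ℕ} {L : ℝ} (ht : 0 < t) (hL : 0 ≤ L) (n : ℕ) :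
    ∀ P : Finset V, #P = n → #P ≤ K ^ t → ∃ E : Finset (V × V), #E ≤ K * #P ∧
      (∀ e ∈ E, d e.1 e.2 ≤ t * L) ∧
      ∀ x ∈ P, ∀ y ∈ P, d x y ≤ L → ∃ c, (c, x) ∈ E ∧ (c, y) ∈ E := by
  induction n using Nat.strong_induction_on with
  | _ n ih =>
    intro P hn hP
    rcases P.eq_empty_or_nonempty with rfl | ⟨c, hc⟩
    · exact ⟨∅, by simp⟩
    · set B : ℕ → Finset V := fun j => {x ∈ P | d c x ≤ j * L} with hB
      have hcB : ∀ j, c ∈ B j := fun j => mem_filter.mpr ⟨hc, by rw [hd.self]; positivity⟩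
      obtain ⟨j, hj, hgrow⟩ : ∃ j < t, #(B (j + 1)) ≤ K * #(B j) := by
        by_contra! hcon
        have key : ∀ j ≤ t, K ^ j + j ≤ #(B j) := by
          intro j hj
          induction j with
          | zero => simpa using card_pos.mpr ⟨c, hcB 0⟩
          | succ j ihj =>
            have h1 := ihj (by omega)
            have h2 := hcon j (by omega)
            have h3 : K * (K ^ j + j) ≤ K * #(B j) := Nat.mul_le_mul_left K h1
            rcases Nat.eq_zero_or_pos K with rfl | hK
            · rw [zero_pow (by omega)] at hP
              have := card_pos.mpr ⟨c, hc⟩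
              omega
            · have h4 : j ≤ K * j := Nat.le_mul_of_pos_left j hK
              rw [mul_add, ← pow_succ'] at h3
              omega
        have h1 := key t le_rfl
        have h2 : #(B t) ≤ #P := card_le_card (filter_subset _ _)
        omega
      have hlt : #(P \ B j) < n := by
        rw [← hn]
        exact card_lt_card ⟨sdiff_subset, fun h => (mem_sdiff.mp (h hc)).2 (hcB j)⟩
      obtain ⟨E, hE1, hE2, hE3⟩ := ih _ hlt (P \ B j) rfl ((card_le_card sdiff_subset).trans hP)
      refine ⟨(B (j + 1)).image (fun x => (c, x)) ∪ E, ?_, ?_, ?_⟩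
      · refine (card_union_le _ _).trans ?_
        have h1 : #((B (j + 1)).image (fun x => (c, x))) ≤ #(B (j + 1)) := card_image_le
        have h2 : #(P \ B j) + #(B j) = #P := card_sdiff_add_card_eq_card (filter_subset _ _)
        rw [← h2, mul_add]
        omega
      · intro e he
        rcases mem_union.mp he with he | he
        · obtain ⟨x, hx, rfl⟩ := mem_image.mp he
          refine (mem_filter.mp hx).2.trans (mul_le_mul_of_nonneg_right ?_ hL)
          exact_mod_cast hj
        · exact hE2 e he
      · have hstep : ∀ x ∈ P, ∀ y ∈ P, d x y ≤ L → x ∈ B j → x ∈ B (j + 1) ∧ y ∈ B (j + 1) := by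
          intro x hx y hy hxy hxB
          have h1 := (mem_filter.mp hxB).2
          have h2 := hd.tri c x y
          refine ⟨mem_filter.mpr ⟨hx, ?_⟩, mem_filter.mpr ⟨hy, ?_⟩⟩ <;> push_cast <;> linarith
        have hmem : ∀ x, x ∈ B (j + 1) → (c, x) ∈ (B (j + 1)).image (fun x => (c, x)) ∪ E :=
          fun x hx => mem_union_left _ (mem_image_of_mem _ hx)
        intro x hx y hy hxy
        by_cases hxB : x ∈ B j
        · obtain ⟨h1, h2⟩ := hstep x hx y hy hxy hxB
          exact ⟨c, hmem x h1, hmem y h2⟩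
        · by_cases hyB : y ∈ B j
          · obtain ⟨h1, h2⟩ := hstep y hy x hx (by rwa [hd.comm]) hyB
            exact ⟨c, hmem x h2, hmem y h1⟩
          · obtain ⟨c', h1, h2⟩ := hE3 x (mem_sdiff.mpr ⟨hx, hxB⟩) y (mem_sdiff.mpr ⟨hy, hyB⟩) hxy
            exact ⟨c', mem_union_right _ h1, mem_union_right _ h2⟩

end Metric

section Tour

variable {V : Type*} [Fintype V]

lemma isDist_wdist {A : SimpleGraph V} {w : Sym2 V → ℝ} (hA : A.Connected) (hw : NonnegOn A w) :
    IsDist (wdist A w) where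
  nonneg _ _ := wdist_nonneg hw
  self _ := wdist_self hw
  comm := wdist_comm A w
  tri _ _ _ := wdist_triangle hw (hA.preconnected _ _) (hA.preconnected _ _)

/-- A connected weighted graph is dominated by a line metric of at most twice its length. -/
lemma exists_tour {A : SimpleGraph V} {w : Sym2 V → ℝ} (hA : A.Connected) (hw : NonnegOn A w) :
    ∃ f : V → ℝ, (∀ x, 0 ≤ f x ∧ f x ≤ 2 * wWeight A w) ∧
      ∀ u v, wdist A w u v ≤ |f u - f v| := by
  have hd := isDist_wdist hA hw
  obtain ⟨x₀⟩ := hA.nonempty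
  have hEw : ∀ e ∈ A.edgeSet, 0 ≤ w e := by
    intro e he
    induction e with
    | _ a b => exact hw a b he
  have key : ∀ k < Fintype.card V, ∃ (S : Finset V) (E : Finset (Sym2 V)) (f : V → ℝ),
      #S = k + 1 ∧ x₀ ∈ S ∧ (∀ e ∈ E, e ∈ A.edgeSet ∧ ∀ x ∈ e, x ∈ S) ∧
      (∀ x ∈ S, 0 ≤ f x ∧ f x ≤ 2 * ∑ e ∈ E, w e) ∧
      ∀ u ∈ S, ∀ v ∈ S, wdist A w u v ≤ |f u - f v| := by
    intro k hk
    induction k with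
    | zero => exact ⟨{x₀}, ∅, 0, by simp [hd.self]⟩
    | succ k ih =>
      obtain ⟨S, E, f, hS, hx₀, hE, hf, hdf⟩ := ih (by omega)
      obtain ⟨y, hy⟩ : ∃ y, y ∉ S := by
        by_contra! hcon
        rw [eq_univ_of_forall hcon, card_univ] at hS
        omega
      obtain ⟨p⟩ := hA.preconnected x₀ y
      obtain ⟨⟨⟨v, u⟩, hvu⟩, -, hv, hu⟩ := p.exists_boundary_dart (S : Set V) hx₀ hy
      replace hv : v ∈ S := hv
      replace hu : u ∉ S := hu
      have ha := hw _ _ hvu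
      set a := w s(v, u) with hadef
      have hEu : s(v, u) ∉ E := fun h => hu ((hE _ h).2 u (Sym2.mem_mk_right v u))
      have hvu' : wdist A w v u ≤ a := wdist_le hw (Rc.adj hvu)
      set g : V → ℝ := fun z => if z = u then f v + a else if f z ≤ f v then f z else f z + 2 * a
        with hg
      have hgu : g u = f v + a := if_pos rfl
      have hgS : ∀ z ∈ S, g z = if f z ≤ f v then f z else f z + 2 * a :=
        fun z hz => if_neg (ne_of_mem_of_not_mem hz hu)
      have hSu : ∀ z ∈ S, wdist A w z u ≤ |g z - g u| := by
        intro z hz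
        rw [hgu, hgS z hz]
        have h1 := hd.tri z v u
        have h2 := hdf z hz v hv
        split_ifs with h
        · rw [abs_sub_comm] at h2 ⊢
          rw [abs_of_nonneg (by linarith)] at h2 ⊢
          linarith
        · rw [abs_of_nonneg (by linarith)] at h2 ⊢
          linarith
      refine ⟨insert u S, insert s(v, u) E, g, ?_, mem_insert_of_mem hx₀, ?_, ?_, ?_⟩
      · rw [card_insert_of_notMem hu, hS]
      · intro e he
        rcases mem_insert.mp he with rfl | he
        · refine ⟨hvu, fun x hx => ?_⟩
          rcases Sym2.mem_iff.mp hx with rfl | rfl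
          · exact mem_insert_of_mem hv
          · exact mem_insert_self _ _
        · exact ⟨(hE e he).1, fun x hx => mem_insert_of_mem ((hE e he).2 x hx)⟩
      · intro z hz
        rw [sum_insert hEu]
        have h1 := hf v hv
        rcases mem_insert.mp hz with rfl | hz
        · rw [hgu]
          constructor <;> linarith
        · rw [hgS z hz]
          have h2 := hf z hz
          split_ifs <;> constructor <;> linarith
      · intro z hz z' hz'
        rcases mem_insert.mp hz with hzu | hzS
        · rw [hzu]
          rcases mem_insert.mp hz' with hzu' | hz'
          · rw [hzu', hd.self]; positivity
          · rw [hd.comm, abs_sub_comm]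
            exact hSu z' hz'
        · replace hz := hzS
          rcases mem_insert.mp hz' with hzu' | hz'
          · rw [hzu']; exact hSu z hz
          · refine (hdf z hz z' hz').trans ?_
            rw [hgS z hz, hgS z' hz']
            split_ifs with h1 h2 h2
            · exact le_rfl
            · rw [abs_sub_comm, abs_sub_comm (f z), abs_of_nonneg (by linarith),
                abs_of_nonneg (by linarith)]
              linarith
            · rw [abs_of_nonneg (by linarith), abs_of_nonneg (by linarith)]
              linarith
            · rw [add_sub_add_right_eq_sub]
  have hpos : 0 < Fintype.card V := Fintype.card_pos_iff.mpr ⟨x₀⟩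
  obtain ⟨S, E, f, hS, -, hE, hf, hdf⟩ := key (Fintype.card V - 1) (by omega)
  have hSu : S = univ := by
    rw [← card_eq_iff_eq_univ]
    omega
  subst hSu
  refine ⟨f, fun x => ⟨(hf x (mem_univ _)).1, (hf x (mem_univ _)).2.trans ?_⟩,
    fun u v => hdf u (mem_univ _) v (mem_univ _)⟩
  refine mul_le_mul_of_nonneg_left ?_ (by norm_num)
  refine sum_le_sum_of_subset_of_nonneg (fun e he => ?_) fun e he _ => ?_
  · simpa using (hE e he).1
  · exact hEw e (by simpa using he)

end Tour

section Forest

variable {V : Type*} {d : V → V → ℝ} {f : V → ℝ} {F : ℝ}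

lemma sum_le_of_separated {g : V → ℝ} (hF : 0 ≤ F) (hf : ∀ x, 0 ≤ f x ∧ f x ≤ F) (hg : ∀ x, 0 ≤ g x ∧ g x ≤ F)
    (B : Finset V)
    (hB : ∀ b ∈ B, ∀ c ∈ B, b ≠ c → (g b + g c) / 4 < |f b - f c|) :
    ∑ b ∈ B, g b ≤ 3 * F := by
  have key : (∀ b ∈ B, ∀ c ∈ B, b ≠ c → (g b + g c) / 4 < |f b - f c|) →
      ∀ y, -F / 4 ≤ y → (∀ b ∈ B, f b + g b / 4 ≤ y) → ∑ b ∈ B, g b ≤ 2 * y + F / 2 := by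
    induction B using Finset.induction_on_max_value f with
    | empty => intro _ y hy _; rw [sum_empty]; linarith
    | insert a s ha hmax ih =>
      have hB' : ∀ b ∈ s, ∀ c ∈ s, b ≠ c → (g b + g c) / 4 < |f b - f c| :=
        fun b hb c hc => hB b (mem_insert_of_mem hb) c (mem_insert_of_mem hc)
      intro _ y hy hby
      have h1 := hby a (mem_insert_self _ _)
      have h2 := ih hB' hB' (f a - g a / 4) (by linarith [(hf a).1, (hg a).2]) fun b hb => by
        have h3 := hB b (mem_insert_of_mem hb) a (mem_insert_self _ _) (ne_of_mem_of_not_mem hb ha)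
        have h4 := hmax b hb
        rw [abs_sub_comm, abs_of_nonneg (by linarith)] at h3
        linarith
      rw [sum_insert ha]
      linarith
  refine (key hB (5 * F / 4) ?_ fun b _ => ?_).trans (by linarith)
  · linarith
  · linarith [hf b, hg b]

/-- A light forest which connects every vertex to a near-optimal point of `N`. -/
lemma exists_forest [Fintype V] (hd : IsDist d) (hf : ∀ x, 0 ≤ f x ∧ f x ≤ F)
    (hdf : ∀ u v, d u v ≤ |f u - f v|) {N : Finset V} (hN : N.Nonempty) :
    ∃ (E : Finset (V × V)) (π : V → V), ∑ e ∈ E, d e.1 e.2 ≤ 3 * F ∧ (∀ v, π v ∈ N) ∧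
      ∀ h, IsDist h → (∀ u v, h u v ≤ |f u - f v|) → (∀ e ∈ E, h e.1 e.2 ≤ d e.1 e.2) →
        ∀ v, ∀ x ∈ N, h v (π v) ≤ 3 * d v x := by
  choose ν hνN hν using fun v => exists_min_image N (d v) hN
  set g : V → ℝ := fun v => d v (ν v) with hg
  have hg0 : ∀ x, 0 ≤ g x ∧ g x ≤ F := fun x => by
    refine ⟨hd.nonneg _ _, (hdf _ _).trans (abs_le.mpr ?_)⟩
    have h1 := hf x
    have h2 := hf (ν x)
    constructor <;> linarith
  have hglip : ∀ u v, g u ≤ |f u - f v| + g v := fun u v =>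
    (hν u _ (hνN v)).trans ((hd.tri u v _).trans (add_le_add_left (hdf u v) _))
  obtain ⟨B, hB, hBmax⟩ := exists_max_image
    {B ∈ (univ : Finset V).powerset | ∀ b ∈ B, ∀ c ∈ B, b ≠ c → (g b + g c) / 4 < |f b - f c|}
    card ⟨∅, by simp⟩
  replace hB := (mem_filter.mp hB).2
  have hcov : ∀ v, ∃ b ∈ B, |f v - f b| ≤ (g v + g b) / 4 := by
    intro v
    by_contra! hcon
    have hvB : v ∉ B := fun h => by
      have := hcon v h
      rw [sub_self, abs_zero] at this
      linarith [(hg0 v).1]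
    have := hBmax (insert v B) (mem_filter.mpr ⟨by simp, ?_⟩)
    · rw [card_insert_of_notMem hvB] at this
      omega
    · intro b hb c hc hbc
      rcases mem_insert.mp hb with hb | hb <;> rcases mem_insert.mp hc with hc | hc
      · exact absurd (hb.trans hc.symm) hbc
      · rw [hb]; exact hcon c hc
      · rw [hc, abs_sub_comm, add_comm]; exact hcon b hb
      · exact hB b hb c hc hbc
  choose β hβB hβ using hcov
  refine ⟨B.image fun b => (b, ν b), fun v => ν (β v), ?_, fun v => hνN _, ?_⟩
  · rw [sum_image fun x _ y _ h => congrArg Prod.fst h]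
    exact sum_le_of_separated (((hf _).1).trans (hf hN.choose).2) hf hg0 B hB
  · intro h hh hhf hhE v x hx
    have h1 := hh.tri v (β v) (ν (β v))
    have h2 := hhf v (β v)
    have h3 : h (β v) (ν (β v)) ≤ g (β v) := hhE _ (mem_image_of_mem _ (hβB v))
    have h4 := hβ v
    have h5 := hglip (β v) v
    have h6 : g v ≤ d v x := hν v x hx
    have h7 := (hg0 v).1
    rw [abs_sub_comm] at h5
    linarith

end Forest

lemma sum_union_le {α : Type*} [DecidableEq α] (s t : Finset α) (φ : α → ℝ) (hφ : ∀ x ∈ t, 0 ≤ φ x) :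
    ∑ x ∈ s ∪ t, φ x ≤ ∑ x ∈ s, φ x + ∑ x ∈ t, φ x := by
  rw [← sum_union_inter]
  exact le_add_of_nonneg_right (sum_nonneg fun x hx => hφ x (mem_of_mem_inter_right hx))

lemma sum_biUnion_le {α ι : Type*} [DecidableEq α] (s : Finset ι) (t : ι → Finset α) (φ : α → ℝ)
    (hφ : ∀ i ∈ s, ∀ x ∈ t i, 0 ≤ φ x) : ∑ x ∈ s.biUnion t, φ x ≤ ∑ i ∈ s, ∑ x ∈ t i, φ x := by
  induction s using Finset.induction_on with
  | empty => simp
  | insert a s ha ih =>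
    rw [biUnion_insert, sum_insert ha, union_comm, add_comm]
    exact (sum_union_le _ _ _ (hφ a (mem_insert_self _ _))).trans
      (add_le_add_left (ih fun i hi => hφ i (mem_insert_of_mem hi)) _)

lemma sum_range_le_of_le_two {a : ℕ → ℝ} (s J : ℕ) (h0 : ∀ j, 0 ≤ a j) (h2 : ∀ j, a j ≤ 2)
    (hs : ∀ j, a j ≤ 2 ^ s / 2 ^ j) : ∑ j ∈ range J, a j ≤ 2 * s + 2 := by
  have h1 : ∑ j ∈ range J, a j ≤ ∑ j ∈ range (s + J), a j :=
    sum_le_sum_of_subset_of_nonneg (range_mono (by omega)) fun j _ _ => h0 j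
  refine h1.trans ?_
  rw [sum_range_add]
  refine add_le_add ?_ ?_
  · refine (sum_le_sum fun j _ => h2 j).trans (le_of_eq ?_)
    rw [sum_const, card_range, nsmul_eq_mul, mul_comm]
  · refine (sum_le_sum fun j _ => (hs (s + j)).trans (le_of_eq ?_)).trans (sum_geometric_two_le J)
    rw [pow_add, div_mul_eq_div_div, div_self (by positivity), one_div_pow]

section Terminals

variable {V : Type*} {d : V → V → ℝ} {f : V → ℝ} {F : ℝ}

/-- The shortcuts serving the pairs at distance about `L`. -/
lemma exists_scale_shortcuts (hd : IsDist d) (hf : ∀ x, 0 ≤ f x ∧ f x ≤ F)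
    (hdf : ∀ u v, d u v ≤ |f u - f v|) {N : Finset V} {K t : ℕ} (ht : 0 < t) (hK : #N ≤ K ^ t)
    {L : ℝ} (hL : 0 < L) {m : ℕ} (hm : F ≤ m * L) :
    ∃ (E : Finset (V × V)) (a : ℕ), a ≤ m + 1 ∧ a ≤ #N ∧
      ∑ e ∈ E, d e.1 e.2 ≤ 3 * t * K * (a * L) ∧
      ∀ h, IsDist h → (∀ u v, h u v ≤ |f u - f v|) → (∀ e ∈ E, h e.1 e.2 ≤ d e.1 e.2) →
        ∀ x ∈ N, ∀ y ∈ N, d x y ≤ L → h x y ≤ (2 + 6 * t) * L := by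
  set c : V → ℕ := fun x => ⌊f x / L⌋₊ with hc
  obtain ⟨P, hPN, hinj, hPim⟩ := exists_subset_injOn_image_eq_of_surjOn (f := c) (N : Set V)
    (N.image c) (by rw [coe_image]; exact Set.surjOn_image _ _)
  have hPN' : P ⊆ N := by exact_mod_cast hPN
  have hPm : #P ≤ m + 1 := by
    rw [← card_image_of_injOn hinj, hPim]
    refine (card_le_card (t := range (m + 1)) fun i hi => ?_).trans (card_range _).le
    obtain ⟨x, -, rfl⟩ := mem_image.mp hi
    rw [mem_range, Nat.lt_succ_iff]
    refine Nat.floor_le_of_le ?_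
    rw [div_le_iff₀ hL]
    exact (hf x).2.trans hm
  have hrep : ∀ x ∈ N, ∃ y ∈ P, |f x - f y| ≤ L := by
    intro x hx
    have h1 : c x ∈ P.image c := hPim ▸ mem_image_of_mem c hx
    obtain ⟨y, hy, hxy⟩ := mem_image.mp h1
    refine ⟨y, hy, ?_⟩
    have h2 : ∀ z, (c z : ℝ) * L ≤ f z ∧ f z < (c z + 1) * L := fun z =>
      ⟨(le_div_iff₀ hL).mp (Nat.floor_le (div_nonneg (hf z).1 hL.le)),
        (div_lt_iff₀ hL).mp (Nat.lt_floor_add_one _)⟩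
    have h3 := h2 x
    have h4 := h2 y
    rw [hxy] at h4
    rw [abs_le]
    constructor <;> linarith
  obtain ⟨E, hE1, hE2, hE3⟩ := exists_stars hd (L := 3 * L) ht (by positivity) _ P rfl
    ((card_le_card hPN').trans hK)
  refine ⟨E, #P, hPm, card_le_card hPN', ?_, ?_⟩
  · refine (sum_le_card_nsmul _ _ _ hE2).trans ?_
    rw [nsmul_eq_mul]
    have h1 : (#E : ℝ) ≤ K * #P := by exact_mod_cast hE1
    have h2 := mul_le_mul_of_nonneg_right h1 (show (0 : ℝ) ≤ t * (3 * L) by positivity)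
    linarith
  · intro h hh hhf hhE x hx y hy hxy
    obtain ⟨x', hx', hxx'⟩ := hrep x hx
    obtain ⟨y', hy', hyy'⟩ := hrep y hy
    have h1 := hdf x x'
    have h2 := hdf y y'
    have h3 := hd.tri x' x y'
    have h4 := hd.tri x y y'
    rw [hd.comm x' x] at h3
    obtain ⟨z, hzx, hzy⟩ := hE3 x' hx' y' hy' (by linarith)
    have h5 := (hhE _ hzx).trans (hE2 _ hzx)
    have h6 := (hhE _ hzy).trans (hE2 _ hzy)
    have h7 := hh.tri x x' y
    have h8 := hh.tri x' z y
    have h9 := hh.tri z y' y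
    have h10 := hhf x x'
    have h11 := hhf y y'
    dsimp only at h5 h6
    rw [hh.comm z x'] at h5
    rw [hh.comm y y'] at h11
    linarith

/-- A light set of shortcuts which preserves the distances between points of `N` up to a
constant factor. -/
lemma exists_terminals (hd : IsDist d) (hF : 0 < F) (hf : ∀ x, 0 ≤ f x ∧ f x ≤ F)
    (hdf : ∀ u v, d u v ≤ |f u - f v|) {N : Finset V} (hpos : ∀ x ∈ N, ∀ y ∈ N, x ≠ y → 0 < d x y)
    {K t s : ℕ} (ht : 0 < t) (hK : #N ≤ K ^ t) (hs : #N ≤ 2 ^ s) :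
    ∃ E : Finset (V × V), ∑ e ∈ E, d e.1 e.2 ≤ 3 * t * K * (2 * s + 2) * F ∧
      ∀ h, IsDist h → (∀ u v, h u v ≤ |f u - f v|) → (∀ e ∈ E, h e.1 e.2 ≤ d e.1 e.2) →
        ∀ x ∈ N, ∀ y ∈ N, h x y ≤ (4 + 12 * t) * d x y := by
  choose E a ha1 ha2 hE1 hE2 using fun j : ℕ => exists_scale_shortcuts hd hf hdf ht hK (L := F / 2 ^ j)
    (by positivity) (m := 2 ^ j) (by push_cast; rw [mul_div_cancel₀ _ (by positivity)])
  obtain ⟨J, hJ⟩ : ∃ J : ℕ, ∀ x ∈ N, ∀ y ∈ N, x ≠ y → F / 2 ^ J < d x y := by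
    have h1 : ∀ e ∈ N.offDiag, ∃ J : ℕ, F / 2 ^ J < d e.1 e.2 := by
      intro e he
      rw [mem_offDiag] at he
      have h2 := hpos _ he.1 _ he.2.1 he.2.2
      obtain ⟨J, hJ⟩ := pow_unbounded_of_one_lt (F / d e.1 e.2) (one_lt_two (α := ℝ))
      refine ⟨J, ?_⟩
      rw [div_lt_iff₀ h2] at hJ
      rw [div_lt_iff₀ (by positivity)]
      linarith
    choose! j hj using h1
    refine ⟨N.offDiag.sup j, fun x hx y hy hxy => ?_⟩
    have hmem : (x, y) ∈ N.offDiag := mem_offDiag.mpr ⟨hx, hy, hxy⟩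
    refine lt_of_le_of_lt ?_ (hj _ hmem)
    exact div_le_div_of_nonneg_left hF.le (by positivity)
      (pow_le_pow_right₀ one_le_two (le_sup (f := j) hmem))
  refine ⟨(range J).biUnion E, ?_, ?_⟩
  · refine (sum_biUnion_le _ _ (fun e : V × V => d e.1 e.2) fun _ _ _ _ => hd.nonneg _ _).trans ?_
    refine (sum_le_sum fun j _ => hE1 j).trans ?_
    have h1 := sum_range_le_of_le_two (a := fun j => (a j : ℝ) / 2 ^ j) s J
      (fun j => by positivity) (fun j => ?_) (fun j => ?_)
    · rw [← mul_sum]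
      have h2 : ∑ j ∈ range J, (a j : ℝ) * (F / 2 ^ j) = (∑ j ∈ range J, (a j : ℝ) / 2 ^ j) * F := by
        rw [sum_mul]
        exact sum_congr rfl fun j _ => by ring
      rw [h2, mul_assoc _ _ F]
      gcongr
    · rw [div_le_iff₀ (by positivity)]
      have h3 : (a j : ℝ) ≤ 2 ^ j + 1 := by exact_mod_cast ha1 j
      have h4 : (1 : ℝ) ≤ 2 ^ j := one_le_pow₀ one_le_two
      linarith
    · gcongr
      exact_mod_cast (ha2 j).trans hs
  · intro h hh hhf hhE x hx y hy
    by_cases hxy : x = y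
    · rw [hxy, hh.self, hd.self, mul_zero]
    · have hex : ∃ j, F / 2 ^ j < d x y := ⟨J, hJ x hx y hy hxy⟩
      have h1 := Nat.find_spec hex
      have h2 : Nat.find hex ≤ J := Nat.find_min' hex (hJ x hx y hy hxy)
      obtain ⟨j, hj⟩ : ∃ j, Nat.find hex = j + 1 := by
        refine Nat.exists_eq_succ_of_ne_zero fun h0 => ?_
        rw [h0, pow_zero, div_one] at h1
        refine absurd (hdf x y) (not_le.mpr (lt_of_le_of_lt (abs_le.mpr ?_) h1))
        have h3 := hf x
        have h4 := hf y
        constructor <;> linarith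
      have h3 := not_lt.mp (Nat.find_min hex (m := j) (by omega))
      rw [hj, pow_succ, div_mul_eq_div_div, div_lt_iff₀ two_pos] at h1
      refine (hE2 j h hh hhf (fun e he => hhE e (mem_biUnion.mpr ⟨j, ?_, he⟩)) x hx y hy h3).trans ?_
      · rw [mem_range]; omega
      · have h4 : (2 + 6 * (t : ℝ)) * (F / 2 ^ j) ≤ (2 + 6 * t) * (d x y * 2) :=
          mul_le_mul_of_nonneg_left h1.le (by positivity)
        linarith

end Terminals

section Shortcuts

variable {V : Type*} [Fintype V] {d : V → V → ℝ} {f : V → ℝ} {F : ℝ}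

/-- A light set of shortcuts which preserves all distances up to a constant factor and an additive
error controlled by the distances to `N`. -/
lemma exists_shortcuts (hd : IsDist d) (hF : 0 < F) (hf : ∀ x, 0 ≤ f x ∧ f x ≤ F)
    (hdf : ∀ u v, d u v ≤ |f u - f v|) (hpos : ∀ x y, x ≠ y → 0 < d x y) {N : Finset V}
    (hN : N.Nonempty) {l : ℕ} (hl : #N ≤ 2 ^ (16 * l)) :
    ∃ E : Finset (V × V), ∑ e ∈ E, d e.1 e.2 ≤ 1000 * 8 ^ l * F ∧
      ∀ h, IsDist h → (∀ u v, h u v ≤ |f u - f v|) → (∀ e ∈ E, h e.1 e.2 ≤ d e.1 e.2) →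
        ∀ u v, ∀ x ∈ N, ∀ y ∈ N, h u v ≤ 100 * d u v + 303 * (d u x + d v y) := by
  obtain ⟨E₁, π, hE₁, hπN, hπ⟩ := exists_forest hd hf hdf hN
  obtain ⟨E₂, hE₂, hter⟩ := exists_terminals hd hF hf hdf (N := N) (K := 4 ^ l) (t := 8)
    (s := 16 * l) (fun x _ y _ => hpos x y) (by norm_num)
    (hl.trans (le_of_eq (by rw [← pow_mul, show 4 = 2 ^ 2 by norm_num, ← pow_mul]; congr 1; ring)))
    hl
  refine ⟨E₁ ∪ E₂, ?_, ?_⟩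
  · refine (sum_union_le E₁ E₂ (fun e : V × V => d e.1 e.2) fun _ _ => hd.nonneg _ _).trans ?_
    refine (add_le_add hE₁ hE₂).trans ?_
    rw [← add_mul]
    refine mul_le_mul_of_nonneg_right ?_ hF.le
    have h1 : ((l : ℝ) + 1) ≤ 2 ^ l := by exact_mod_cast Nat.lt_two_pow_self (n := l)
    have h2 : (8 : ℝ) ^ l = 4 ^ l * 2 ^ l := by rw [← mul_pow]; norm_num
    have h3 : (1 : ℝ) ≤ 8 ^ l := one_le_pow₀ (by norm_num)
    have h4 : (4 : ℝ) ^ l * (l + 1) ≤ 8 ^ l := by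
      rw [h2]
      exact mul_le_mul_of_nonneg_left h1 (by positivity)
    have h5 : (1 : ℝ) ≤ 4 ^ l := one_le_pow₀ (by norm_num)
    push_cast
    nlinarith
  · intro h hh hhf hhE u v x hx y hy
    have h1 := hπ h hh hhf fun e he => hhE e (mem_union_left _ he)
    have h2 := hπ d hd hdf fun e _ => le_rfl
    have h3 := hter h hh hhf (fun e he => hhE e (mem_union_right _ he)) _ (hπN u) _ (hπN v)
    have h4 := h1 u x hx
    have h5 := h1 v y hy
    have h6 := h2 u x hx
    have h7 := h2 v y hy
    have h8 := hh.tri u (π u) v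
    have h9 := hh.tri (π u) (π v) v
    have h10 := hd.tri (π u) u (π v)
    have h11 := hd.tri u v (π v)
    rw [hh.comm (π v) v] at h9
    rw [hd.comm (π u) u] at h10
    push_cast at h3
    linarith

/-- A net adapted to a density function. -/
lemma exists_net (hd : IsDist d) {R : V → ℝ} (hR : ∀ v, 0 ≤ R v) {m : ℕ}
    (hm : ∀ v, m ≤ #{u | d v u ≤ R v}) :
    ∃ N : Finset V, #N * m ≤ Fintype.card V ∧ ∀ v, ∃ x ∈ N, d v x ≤ 2 * R v := by
  have key : ∀ s : Finset V, ∃ N ⊆ s,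
      (∀ x ∈ N, ∀ y ∈ N, x ≠ y → Disjoint ({u | d x u ≤ R x} : Finset V) ({u | d y u ≤ R y} : Finset V)) ∧
      ∀ v ∈ s, ∃ x ∈ N, d v x ≤ 2 * R v := by
    intro s
    induction s using Finset.induction_on_max_value R with
    | empty => exact ⟨∅, by simp⟩
    | insert a s ha hmax ih =>
      obtain ⟨N, hNs, hdisj, hcov⟩ := ih
      by_cases h : ∀ x ∈ N, Disjoint ({u | d x u ≤ R x} : Finset V) ({u | d a u ≤ R a} : Finset V)
      · refine ⟨insert a N, insert_subset_insert _ hNs, ?_, ?_⟩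
        · intro x hx y hy hxy
          rcases mem_insert.mp hx with hx | hx <;> rcases mem_insert.mp hy with hy | hy
          · exact absurd (hx.trans hy.symm) hxy
          · rw [hx]; exact (h y hy).symm
          · rw [hy]; exact h x hx
          · exact hdisj x hx y hy hxy
        · intro v hv
          rcases mem_insert.mp hv with hv | hv
          · refine ⟨a, mem_insert_self _ _, ?_⟩
            rw [hv, hd.self]
            linarith [hR a]
          · obtain ⟨x, hx, hvx⟩ := hcov v hv
            exact ⟨x, mem_insert_of_mem hx, hvx⟩
      · push Not at h
        obtain ⟨x, hx, hxa⟩ := h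
        refine ⟨N, hNs.trans (subset_insert _ _), hdisj, ?_⟩
        intro v hv
        rcases mem_insert.mp hv with hv | hv
        · obtain ⟨z, hz1, hz2⟩ := not_disjoint_iff.mp hxa
          simp only [mem_filter, mem_univ, true_and] at hz1 hz2
          refine ⟨x, hx, ?_⟩
          have h1 := hmax x (hNs hx)
          have h2 := hd.tri a z x
          rw [hd.comm z x] at h2
          rw [hv]
          linarith
        · exact hcov v hv
  obtain ⟨N, -, hdisj, hcov⟩ := key univ
  refine ⟨N, ?_, fun v => hcov v (mem_univ v)⟩
  have h1 := card_biUnion (s := N) (t := fun x => ({u | d x u ≤ R x} : Finset V)) hdisj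
  have h2 := sum_le_sum fun x (_ : x ∈ N) => hm x
  rw [sum_const, smul_eq_mul, ← h1] at h2
  exact h2.trans (card_le_univ _)

end Shortcuts

lemma sum_toFinset_le {α : Type*} [DecidableEq α] (φ : α → ℝ) (l : List α)
    (hφ : ∀ x ∈ l, 0 ≤ φ x) : ∑ x ∈ l.toFinset, φ x ≤ (l.map φ).sum := by
  induction l with
  | nil => simp
  | cons a l ih =>
    have h1 := ih fun x hx => hφ x (List.mem_cons_of_mem _ hx)
    have h2 := hφ a List.mem_cons_self
    rw [List.toFinset_cons, List.map_cons, List.sum_cons]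
    by_cases ha : a ∈ l.toFinset
    · rw [insert_eq_of_mem ha]; linarith
    · rw [sum_insert ha]; linarith

section Levels

variable {V : Type*} [Fintype V]

lemma exists_radius (d : V → V → ℝ) (hd : ∀ u v, 0 ≤ d u v) {m : ℕ} (hm : 0 < m)
    (hmV : m ≤ Fintype.card V) (v : V) :
    ∃ r, 0 ≤ r ∧ m ≤ #{u | d v u ≤ r} ∧ #{u | d v u < r} < m := by
  obtain ⟨z, -, hz⟩ := exists_max_image univ (d v) ⟨v, mem_univ v⟩
  obtain ⟨x, hx, hmin⟩ := exists_min_image {x | m ≤ #{u | d v u ≤ d v x}} (d v) ⟨z, by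
    rw [mem_filter]
    refine ⟨mem_univ _, hmV.trans (le_of_eq ?_)⟩
    rw [filter_true_of_mem hz, card_univ]⟩
  refine ⟨d v x, hd _ _, (mem_filter.mp hx).2, ?_⟩
  by_contra! hcon
  obtain ⟨y, hy, hmax⟩ := exists_max_image {u | d v u < d v x} (d v)
    (card_pos.mp (hm.trans_le hcon))
  refine absurd (hmin y (mem_filter.mpr ⟨mem_univ _, hcon.trans (card_le_card fun u hu => ?_)⟩))
    (not_le.mpr (mem_filter.mp hy).2)
  exact mem_filter.mpr ⟨mem_univ _, hmax u hu⟩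

lemma exists_level_net [Nonempty V] {d : V → V → ℝ} (hd : IsDist d) (l : ℕ) :
    ∃ (R : V → ℝ) (N : Finset V), N.Nonempty ∧ #N ≤ 2 ^ l ∧ (∀ v, ∃ x ∈ N, d v x ≤ 2 * R v) ∧
      ∀ v, #{u | d v u < R v} * 2 ^ l ≤ Fintype.card V := by
  have hn : 0 < Fintype.card V := Fintype.card_pos
  set n := Fintype.card V
  obtain ⟨q, hq1, hq2, hq3⟩ : ∃ q, q * 2 ^ l ≤ n - 1 ∧ n - 1 < (q + 1) * 2 ^ l ∧ q ≤ n - 1 := by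
    refine ⟨(n - 1) / 2 ^ l, Nat.div_mul_le_self _ _, ?_, Nat.div_le_self _ _⟩
    rw [mul_comm]
    exact Nat.lt_mul_div_succ (n - 1) (by positivity)
  choose R hR0 hRm hRlt using exists_radius d hd.nonneg (m := q + 1) (by omega) (by omega)
  obtain ⟨N, hN, hcov⟩ := exists_net hd hR0 hRm
  refine ⟨R, N, ?_, ?_, hcov, fun v => ?_⟩
  · obtain ⟨v⟩ := ‹Nonempty V›
    obtain ⟨x, hx, -⟩ := hcov v
    exact ⟨x, hx⟩
  · refine Nat.le_of_mul_le_mul_right (c := q + 1) ?_ (by omega)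
    rw [mul_comm (2 ^ l)]
    omega
  · have h3 := Nat.mul_le_mul_right (2 ^ l) (Nat.lt_succ_iff.mp (hRlt v))
    omega

/-- A moment bound from geometrically decreasing numbers of bad elements. -/
lemma sum_le_of_levels {α : Type*} (S : Finset α) (φ : α → ℝ) (B : ℕ → α → Prop) {A Q : ℝ}
    (hA : 0 ≤ A) {L : ℕ} (hφ : ∀ p ∈ S, ∀ l ≤ L, ¬ B l p → φ p ≤ A * 4096 ^ l)
    (hL : ∀ p ∈ S, ¬ B L p) (hS : #S ≤ Q) (hB : ∀ l, (#{p ∈ S | B l p} : ℝ) * 65536 ^ l ≤ 2 * Q) :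
    ∑ p ∈ S, φ p ≤ 16385 * A * Q := by
  have hpt : ∀ p ∈ S, φ p ≤ A * (1 + ∑ l ∈ range L, if B l p then 4096 ^ (l + 1) else 0) := by
    intro p hp
    have hex : ∃ l, ¬ B l p := ⟨L, hL p hp⟩
    have h1 := Nat.find_spec hex
    have h2 : Nat.find hex ≤ L := Nat.find_min' hex (hL p hp)
    refine (hφ p hp _ h2 h1).trans (mul_le_mul_of_nonneg_left ?_ hA)
    have h0 : ∀ l ∈ range L, (0 : ℝ) ≤ if B l p then 4096 ^ (l + 1) else 0 := fun l _ => by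
      split_ifs <;> positivity
    rcases h3 : Nat.find hex with _ | k
    · rw [pow_zero]
      exact le_add_of_nonneg_right (sum_nonneg h0)
    · have h4 := not_not.mp (Nat.find_min hex (m := k) (by omega))
      have h5 := single_le_sum h0 (mem_range.mpr (by omega : k < L))
      rw [if_pos h4] at h5
      linarith
  refine (sum_le_sum hpt).trans ?_
  rw [← mul_sum, sum_add_distrib, sum_comm]
  have h1 : ∑ l ∈ range L, ∑ p ∈ S, (if B l p then (4096 : ℝ) ^ (l + 1) else 0) ≤
      ∑ l ∈ range L, 8192 * Q * (1 / 2) ^ l := by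
    refine sum_le_sum fun l _ => ?_
    rw [← sum_filter, sum_const, nsmul_eq_mul]
    have hQ : 0 ≤ Q := (Nat.cast_nonneg _).trans hS
    have h2 := hB l
    rw [← le_div_iff₀ (by positivity)] at h2
    refine (mul_le_mul_of_nonneg_right h2 (by positivity)).trans ?_
    have h3 : (4096 : ℝ) ^ l ≤ (1 / 2) ^ l * 65536 ^ l := by
      rw [← mul_pow]
      exact pow_le_pow_left₀ (by norm_num) (by norm_num) _
    rw [div_mul_eq_mul_div, div_le_iff₀ (by positivity), pow_succ]
    have := mul_le_mul_of_nonneg_left h3 (show 0 ≤ 8192 * Q by positivity)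
    linarith
  rw [← mul_sum] at h1
  have hQ : 0 ≤ Q := (Nat.cast_nonneg _).trans hS
  have h2 := mul_le_mul_of_nonneg_left (sum_geometric_two_le L) (show 0 ≤ 8192 * Q by positivity)
  rw [sum_const, nsmul_eq_mul, mul_one]
  have h3 : (#S : ℝ) + ∑ l ∈ range L, ∑ p ∈ S, (if B l p then (4096 : ℝ) ^ (l + 1) else 0) ≤
      16385 * Q := by linarith
  have := mul_le_mul_of_nonneg_left h3 hA
  linarith

end Levels

section Spanner

variable {V : Type*} [Fintype V] {G T₀ : SimpleGraph V} {w : Sym2 V → ℝ}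

lemma wdist_pos_of_connected (hG : G.Connected) (hw : ∀ a b, G.Adj a b → 0 < w s(a, b)) (x y : V)
    (hxy : x ≠ y) : 0 < wdist G w x y := wdist_pos hw (hG.preconnected _ _) hxy

/-- A light set of edges of `G` whose addition to `T₀` preserves the distances of the pairs which
are far compared to the radius of a ball with `n / 65536 ^ l` vertices. -/
lemma exists_level (hG : G.Connected) (hw : ∀ a b, G.Adj a b → 0 < w s(a, b))
    (hT₀ : T₀.Connected) (hT₀G : T₀ ≤ G) (hW : 0 < wWeight T₀ w) {M : ℝ} (hM : 1 ≤ M) (l : ℕ) :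
    ∃ (D : Finset (Sym2 V)) (R : V → ℝ), (∀ e ∈ D, e ∈ G.edgeSet) ∧
      ∑ e ∈ D, w e ≤ 2000 * 8 ^ l * wWeight T₀ w / M ∧
      (∀ v, #{u | wdist G w v u < R v} * 65536 ^ l ≤ Fintype.card V) ∧
      ∀ H, T₀ ≤ H → H ≤ G → (∀ e ∈ D, e ∈ H.edgeSet) → ∀ u v, R u ≤ wdist G w u v →
        R v ≤ wdist G w u v → wdist H w u v ≤ 1312 * M * wdist G w u v := by
  have hM0 : 0 < M := by linarith
  have hwn : NonnegOn G w := fun a b h => (hw a b h).le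
  have hwe : ∀ e ∈ G.edgeSet, 0 < w e := by
    intro e he
    induction e with
    | _ a b => exact hw a b he
  set wM : Sym2 V → ℝ := fun e => if e ∈ T₀.edgeSet then w e else M * w e with hwM
  have hwM1 : ∀ e ∈ G.edgeSet, w e ≤ wM e ∧ wM e ≤ M * w e := by
    intro e he
    have h1 := hwe e he
    have h2 : w e ≤ M * w e := le_mul_of_one_le_left h1.le hM
    simp only [hwM]
    split_ifs
    · exact ⟨le_rfl, h2⟩
    · exact ⟨h2, le_rfl⟩
  have hwMpos : ∀ a b, G.Adj a b → 0 < wM s(a, b) := fun a b h =>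
    (hw a b h).trans_le (hwM1 s(a, b) h).1
  have hwMn : NonnegOn G wM := fun a b h => (hwMpos a b h).le
  obtain ⟨f, hf, hdf⟩ := exists_tour hT₀ (hwn.mono hT₀G)
  have hdMT : ∀ u v, wdist G wM u v ≤ wdist T₀ w u v := fun u v =>
    wdist_le hwMn ((rc_wdist (hwn.mono hT₀G) (hT₀.preconnected _ _)).map hT₀G
      fun x y hxy => (if_pos (show s(x, y) ∈ T₀.edgeSet from hxy)).le)
  have hdMG : ∀ u v, wdist G wM u v ≤ M * wdist G w u v := fun u v =>
    wdist_le hwMn ((rc_wdist hwn (hG.preconnected _ _)).map_mul hM0.le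
      fun x y hxy => (Rc.adj hxy).le (hwM1 s(x, y) hxy).2)
  have hne : Nonempty V := hG.nonempty
  obtain ⟨R, N, hN, hNl, hcov, hR⟩ := exists_level_net (isDist_wdist hG hwn) (16 * l)
  obtain ⟨E, hE, hEd⟩ := exists_shortcuts (isDist_wdist hG hwMn)
    (by positivity : 0 < 2 * wWeight T₀ w) hf (fun u v => (hdMT u v).trans (hdf u v))
    (wdist_pos_of_connected hG hwMpos) hN hNl
  choose p hp using fun e : V × V => rc_wdist hwMn (hG.preconnected e.1 e.2)
  refine ⟨E.biUnion fun e => {x ∈ (p e).edges.toFinset | x ∉ T₀.edgeSet}, R, ?_, ?_, ?_, ?_⟩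
  · intro e he
    obtain ⟨e', -, he'⟩ := mem_biUnion.mp he
    exact (p e').edges_subset_edgeSet (List.mem_toFinset.mp (mem_filter.mp he').1)
  · rw [le_div_iff₀ hM0, mul_comm, mul_sum]
    have hpos : ∀ i ∈ E, ∀ x ∈ ({x ∈ (p i).edges.toFinset | x ∉ T₀.edgeSet} : Finset (Sym2 V)),
        0 ≤ M * w x := fun i _ x hx => mul_nonneg hM0.le
      (hwe x ((p i).edges_subset_edgeSet (List.mem_toFinset.mp (mem_filter.mp hx).1))).le
    refine (sum_biUnion_le E _ (fun x => M * w x) hpos).trans ?_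
    refine (sum_le_sum fun e he => ?_).trans (hE.trans (le_of_eq (by ring)))
    have hwMe : ∀ x ∈ (p e).edges, 0 ≤ wM x := fun x hx =>
      (hwe x ((p e).edges_subset_edgeSet hx)).le.trans
        (hwM1 x ((p e).edges_subset_edgeSet hx)).1
    calc ∑ x ∈ (p e).edges.toFinset with x ∉ T₀.edgeSet, M * w x
        = ∑ x ∈ (p e).edges.toFinset with x ∉ T₀.edgeSet, wM x :=
          sum_congr rfl fun x hx => (if_neg (mem_filter.mp hx).2).symm
      _ ≤ ∑ x ∈ (p e).edges.toFinset, wM x :=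
          sum_le_sum_of_subset_of_nonneg (filter_subset _ _) fun x hx _ =>
            hwMe x (List.mem_toFinset.mp hx)
      _ ≤ wlen wM (p e) := sum_toFinset_le _ _ hwMe
      _ ≤ _ := hp e
  · intro v
    have := hR v
    rwa [pow_mul] at this
  · intro H hTH hHG hDH u v hu hv
    have hH : H.Connected := hT₀.mono hTH
    have hwH := hwn.mono hHG
    have hshort : ∀ e ∈ E, wdist H w e.1 e.2 ≤ wdist G wM e.1 e.2 := by
      intro e he
      have hmem : ∀ x ∈ (p e).edges, x ∈ H.edgeSet := by
        intro x hx
        by_cases hxT : x ∈ T₀.edgeSet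
        · exact SimpleGraph.edgeSet_mono hTH hxT
        · exact hDH x (mem_biUnion.mpr ⟨e, he, mem_filter.mpr ⟨List.mem_toFinset.mpr hx, hxT⟩⟩)
      refine wdist_le hwH ⟨(p e).transfer H hmem, le_trans ?_ (hp e)⟩
      rw [wlen, wlen, SimpleGraph.Walk.edges_transfer]
      exact List.sum_le_sum fun x hx => (hwM1 x ((p e).edges_subset_edgeSet hx)).1
    obtain ⟨x, hx, hux⟩ := hcov u
    obtain ⟨y, hy, hvy⟩ := hcov v
    have h1 := hEd _ (isDist_wdist hH hwH)
      (fun a b => (wdist_le hwH ((rc_wdist (hwH.mono hTH)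
        (hT₀.preconnected _ _)).mono hTH)).trans (hdf a b)) hshort u v x hx y hy
    have h2 := hdMG u v
    have h3 := (hdMG u x).trans (mul_le_mul_of_nonneg_left (hux.trans
      (mul_le_mul_of_nonneg_left hu two_pos.le)) hM0.le)
    have h4 := (hdMG v y).trans (mul_le_mul_of_nonneg_left (hvy.trans
      (mul_le_mul_of_nonneg_left hv two_pos.le)) hM0.le)
    linarith

/-- Every spanning tree can be augmented to a light spanner with a bounded third moment. -/
lemma exists_light_spanner (hG : G.Connected) (hw : ∀ a b, G.Adj a b → 0 < w s(a, b))
    (hT₀ : T₀.Connected) (hT₀G : T₀ ≤ G) (hW : 0 < wWeight T₀ w) {ρ : ℝ} (hρ : 0 < ρ)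
    (hρ1 : ρ < 1) :
    ∃ H, T₀ ≤ H ∧ H ≤ G ∧ wWeight H w ≤ (1 + ρ) * wWeight T₀ w ∧
      ∑ e ∈ univ.offDiag, (ρ * (wdist H w e.1 e.2 / wdist G w e.1 e.2)) ^ 3 ≤
        16385 * 5248000 ^ 3 * (Fintype.card V : ℝ) ^ 2 := by
  have hwn : NonnegOn G w := fun a b h => (hw a b h).le
  have hwe : ∀ e ∈ G.edgeSet, 0 ≤ w e := by
    intro e he
    induction e with
    | _ a b => exact (hw a b he).le
  have hM : ∀ l : ℕ, (1 : ℝ) ≤ 4000 * 16 ^ l / ρ := fun l => by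
    rw [one_le_div hρ]
    have : (1 : ℝ) ≤ 16 ^ l := one_le_pow₀ (by norm_num)
    linarith
  choose D R hDG hDw hR hH using fun l => exists_level hG hw hT₀ hT₀G hW (hM l) l
  set n := Fintype.card V with hn
  set S := (range (n + 1)).biUnion D with hS
  set H : SimpleGraph V := T₀ ⊔ SimpleGraph.fromEdgeSet (S : Set (Sym2 V)) with hHdef
  have hSG : ∀ e ∈ S, e ∈ G.edgeSet := fun e he => by
    obtain ⟨l, -, hl⟩ := mem_biUnion.mp he
    exact hDG l e hl
  have hHedge : H.edgeSet = T₀.edgeSet ∪ S := by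
    rw [hHdef, SimpleGraph.edgeSet_sup, SimpleGraph.edgeSet_fromEdgeSet,
      sdiff_eq_left.mpr (Set.disjoint_left.mpr fun e he => ?_)]
    exact G.not_isDiag_of_mem_edgeSet (hSG e he)
  have hHG : H ≤ G := by
    rw [← SimpleGraph.edgeSet_subset_edgeSet, hHedge]
    exact Set.union_subset (SimpleGraph.edgeSet_mono hT₀G) hSG
  refine ⟨H, le_sup_left, hHG, ?_, ?_⟩
  · have h1 : H.edgeSet.toFinite.toFinset = T₀.edgeSet.toFinite.toFinset ∪ S := by
      ext e
      simp [hHedge]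
    rw [wWeight, h1]
    refine (sum_union_le _ _ w fun e he => hwe e (hSG e he)).trans ?_
    rw [add_mul, one_mul]
    refine add_le_add le_rfl ?_
    refine (sum_biUnion_le _ _ w fun i _ e he => hwe e (hDG i e he)).trans ?_
    have h2 : ∀ l ∈ range (n + 1), ∑ e ∈ D l, w e ≤ ρ * wWeight T₀ w / 2 * (1 / 2) ^ l := by
      intro l _
      refine (hDw l).trans (le_of_eq ?_)
      have h3 : (16 : ℝ) ^ l = 8 ^ l * 2 ^ l := by rw [← mul_pow]; norm_num
      rw [h3, one_div_pow]
      field_simp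
      norm_num
    refine (sum_le_sum h2).trans ?_
    rw [← mul_sum]
    have h4 := mul_le_mul_of_nonneg_left (sum_geometric_two_le (n + 1))
      (show 0 ≤ ρ * wWeight T₀ w / 2 by positivity)
    linarith
  · refine sum_le_of_levels _ _
      (fun l e => wdist G w e.1 e.2 < R l e.1 ∨ wdist G w e.1 e.2 < R l e.2)
      (L := n) (by norm_num) ?_ ?_ ?_ ?_
    · intro e he l hl hbad
      push Not at hbad
      have hpos := wdist_pos_of_connected hG hw e.1 e.2 (mem_offDiag.mp he).2.2
      have h1 := hH l H le_sup_left hHG (fun x hx => by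
        rw [hHedge]
        exact Or.inr (mem_biUnion.mpr ⟨l, mem_range.mpr (by omega), hx⟩)) e.1 e.2 hbad.1 hbad.2
      rw [← div_le_iff₀ hpos] at h1
      have h2 : 0 ≤ wdist H w e.1 e.2 / wdist G w e.1 e.2 :=
        div_nonneg (wdist_nonneg (hwn.mono hHG)) hpos.le
      have h3 : ρ * (wdist H w e.1 e.2 / wdist G w e.1 e.2) ≤ 5248000 * 16 ^ l := by
        refine (mul_le_mul_of_nonneg_left h1 hρ.le).trans (le_of_eq ?_)
        field_simp
        norm_num
      refine (pow_le_pow_left₀ (by positivity) h3 3).trans (le_of_eq ?_)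
      rw [mul_pow, ← pow_mul, mul_comm l, pow_mul]
      norm_num
    · have hcard : ∀ u v, ¬ wdist G w u v < R n u := by
        intro u v huv
        have h1 : 0 < #{v | wdist G w u v < R n u} := card_pos.mpr ⟨v, by simpa using huv⟩
        have h2 := (Nat.le_mul_of_pos_left _ h1).trans (hR n u)
        have h3 : n < 65536 ^ n := Nat.lt_pow_self (by norm_num)
        omega
      rintro ⟨u, v⟩ -
      rintro (h | h)
      · exact hcard _ _ h
      · rw [wdist_comm] at h
        exact hcard _ _ h
    · have h1 : #(univ : Finset V).offDiag ≤ n * n := by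
        rw [offDiag_card, card_univ]
        exact Nat.sub_le _ _
      rw [sq]
      exact_mod_cast h1
    · intro l
      have h1 : #{e ∈ (univ : Finset V).offDiag |
          wdist G w e.1 e.2 < R l e.1 ∨ wdist G w e.1 e.2 < R l e.2} ≤
          2 * ∑ v : V, #{u | wdist G w v u < R l v} := by
        have h2 : #{e : V × V | wdist G w e.1 e.2 < R l e.1} =
            ∑ v : V, #{u | wdist G w v u < R l v} := by
          rw [← card_sigma]
          refine card_bij' (fun e _ => ⟨e.1, e.2⟩) (fun e _ => (e.1, e.2)) ?_ ?_ ?_ ?_ <;> simp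
        have h3 : #{e : V × V | wdist G w e.1 e.2 < R l e.2} =
            ∑ v : V, #{u | wdist G w v u < R l v} := by
          rw [← card_sigma]
          refine card_bij' (fun e _ => ⟨e.2, e.1⟩) (fun e _ => (e.2, e.1)) ?_ ?_ ?_ ?_ <;>
            simp [wdist_comm G w]
        rw [two_mul]
        nth_rewrite 1 [← h2]
        rw [← h3]
        refine le_trans (card_le_card fun e he => ?_) (card_union_le _ _)
        rcases (mem_filter.mp he).2 with h | h
        · exact mem_union_left _ (by simpa using h)
        · exact mem_union_right _ (by simpa using h)
      have h4 : (∑ v : V, #{u | wdist G w v u < R l v}) * 65536 ^ l ≤ n * n := by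
        rw [sum_mul]
        refine (sum_le_card_nsmul _ _ _ fun v _ => hR l v).trans (le_of_eq ?_)
        rw [card_univ, smul_eq_mul]
      have h5 := Nat.mul_le_mul_right (65536 ^ l) h1
      rw [sq]
      have h6 := h5.trans (le_of_eq_of_le (mul_assoc _ _ _) (Nat.mul_le_mul_left 2 h4))
      have h7 : ∀ c : ℕ, c * 65536 ^ l ≤ 2 * (n * n) → (c : ℝ) * 65536 ^ l ≤ 2 * (n * n) :=
        fun c hc => by exact_mod_cast hc
      refine h7 _ ?_
      refine le_of_eq_of_le ?_ h6
      congr 2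
      exact filter_congr_decidable _ _ _

end Spanner

lemma mul_le_rpow_add_cube {a b : ℝ} (ha : 0 ≤ a) (hb : 0 ≤ b) :
    a * b ≤ a ^ (3 / 2 : ℝ) + b ^ 3 := by
  have h1 := Real.young_inequality_of_nonneg ha hb (p := 3 / 2) (q := 3)
    ⟨by norm_num, by norm_num, by norm_num⟩
  have h2 : (0 : ℝ) ≤ a ^ (3 / 2 : ℝ) := Real.rpow_nonneg ha _
  have h3 : b ^ (3 : ℝ) = b ^ 3 := by exact_mod_cast Real.rpow_natCast b 3
  have h4 : 0 ≤ b ^ 3 := by positivity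
  rw [h3] at h1
  linarith

section Final

variable {V : Type*} [Fintype V] {G H : SimpleGraph V} {w : Sym2 V → ℝ}

lemma exists_mst (hG : G.Connected) (w : Sym2 V → ℝ) :
    ∃ T, IsSpanningTree G T ∧ wWeight T w = mstWeight G w := by
  obtain ⟨T₁, h₁, h₁'⟩ := hG.exists_isTree_le
  obtain ⟨T, hT, hmin⟩ := Set.exists_min_image {T | IsSpanningTree G T} (fun T => wWeight T w)
    (Set.toFinite _) ⟨T₁, h₁, h₁'⟩
  refine ⟨T, hT, le_antisymm (le_csInf ⟨_, T, hT, rfl⟩ ?_) (csInf_le ⟨wWeight T w, ?_⟩ ⟨T, hT, rfl⟩)⟩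
  · rintro x ⟨T', hT', rfl⟩
    exact hmin T' hT'
  · rintro x ⟨T', hT', rfl⟩
    exact hmin T' hT'

lemma wWeight_pos (hH : H.Connected) (hw : ∀ e ∈ H.edgeSet, 0 < w e) (hV : 2 ≤ Fintype.card V) :
    0 < wWeight H w := by
  have : Nontrivial V := Fintype.one_lt_card_iff_nontrivial.mp hV
  obtain ⟨v⟩ := hH.nonempty
  obtain ⟨u, hu⟩ := hH.preconnected.exists_adj_of_nontrivial v
  refine sum_pos (fun e he => hw e (by simpa using he)) ⟨s(v, u), by simpa using hu⟩

lemma wWeight_mono {A : SimpleGraph V} (hAH : A ≤ H) (hw : ∀ e ∈ H.edgeSet, 0 < w e) :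
    wWeight A w ≤ wWeight H w := by
  refine sum_le_sum_of_subset_of_nonneg (fun e he => ?_) fun e he _ => (hw e (by simpa using he)).le
  have := SimpleGraph.edgeSet_mono hAH (show e ∈ A.edgeSet by simpa using he)
  simpa using this

end Final

end LightTree


open LightTree

/-- There is a universal constant `C > 0` such that every weighted graph
`G` on at least two vertices and every `0 < ρ < 1` admit a spanning tree `T` of lightness
at most `1 + ρ` with average distortion at most `C/ρ`. -/
theorem stmt1 :
    ∃ C : ℝ, 0 < C ∧
      ∀ (V : Type) [Fintype V] (G : SimpleGraph V) (w : Sym2 V → ℝ),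
        IsWeightedGraph G w → 2 ≤ Fintype.card V →
        ∀ ρ : ℝ, 0 < ρ → ρ < 1 →
          ∃ T : SimpleGraph V, IsSpanningTree G T ∧
            wWeight T w / mstWeight G w ≤ 1 + ρ ∧
            distq G T w 1 ≤ C / ρ := by
  obtain ⟨C, hC, hmoment⟩ := exists_tree_moment
  refine ⟨2 * (C + 16385 * 5248000 ^ 3), by positivity, ?_⟩
  rintro V _ G w ⟨hG, hwe, -⟩ hV ρ hρ hρ1
  have hw : ∀ a b, G.Adj a b → 0 < w s(a, b) := fun a b h => hwe s(a, b) h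
  obtain ⟨T₀, ⟨hT₀G, hT₀⟩, hmst⟩ := exists_mst hG w
  have hmst0 : 0 < wWeight T₀ w := wWeight_pos hT₀.connected
    (fun e he => hwe e (SimpleGraph.edgeSet_mono hT₀G he)) hV
  obtain ⟨H, hT₀H, hHG, hHw, hHsum⟩ := exists_light_spanner hG hw hT₀.connected hT₀G hmst0 hρ hρ1
  have hH : H.Connected := hT₀.connected.mono hT₀H
  have hwH : ∀ a b, H.Adj a b → 0 < w s(a, b) := fun a b h => hw a b (hHG h)
  have hwHn : NonnegOn H w := fun a b h => (hwH a b h).le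
  obtain ⟨T, hTH, hT, hTsum⟩ := hmoment V H w hH hwH
  refine ⟨T, ⟨hTH.trans hHG, hT⟩, ?_, ?_⟩
  · rw [← hmst, div_le_iff₀ hmst0]
    exact (wWeight_mono hTH fun e he => hwe e (SimpleGraph.edgeSet_mono hHG he)).trans hHw
  · have hsum : ρ * ∑ e ∈ (univ : Finset V).offDiag, wdist T w e.1 e.2 / wdist G w e.1 e.2 ≤
        (C + 16385 * 5248000 ^ 3) * (Fintype.card V : ℝ) ^ 2 := by
      rw [mul_sum, add_mul]
      refine le_trans ?_ (add_le_add hTsum hHsum)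
      rw [← sum_add_distrib]
      refine sum_le_sum fun e he => ?_
      have hne := (mem_offDiag.mp he).2.2
      have h1 := wdist_pos_of_connected hG hw e.1 e.2 hne
      have h2 := wdist_pos_of_connected hH hwH e.1 e.2 hne
      have h3 : 0 ≤ wdist T w e.1 e.2 := wdist_nonneg (hwHn.mono hTH)
      refine le_trans (le_of_eq ?_) (mul_le_rpow_add_cube (div_nonneg h3 h2.le)
        (mul_nonneg hρ.le (div_nonneg h2.le h1.le)))
      field_simp
    have hn : (2 : ℝ) ≤ Fintype.card V := by exact_mod_cast hV
    set n : ℝ := (Fintype.card V : ℝ)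
    simp only [distq, Real.rpow_one, div_one]
    rw [div_le_div_iff₀ (by nlinarith) hρ, mul_comm _ ρ]
    refine hsum.trans ?_
    rw [mul_comm 2, mul_assoc]
    refine mul_le_mul_of_nonneg_left ?_ (by positivity)
    nlinarith
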